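/- arXiv:1802.06742 — 2 statements merged into one kernel-verified Lean document; each statement's English description precedes it below -/
import Mathlib

section
/- There is an absolute constant C such that the following holds: for every tree T on n ≥ 2 vertices, every list assignment L giving each vertex of T a finite set of at least 4 colors, and any two L-colorings α and β of T, there exists an L-recoloring schedule from α to β of length at most C·log₂ n. -/
open SimpleGraph

/-- An `L`-coloring for a list assignment `L`: each vertex gets a color from its list,
adjacent vertices get distinct colors. -/
def IsLColoring {V : Type*} (G : SimpleGraph V) (L : V → Finset ℕ) (c : V → ℕ) : Prop :=
  (∀ v, c v ∈ L v) ∧ ∀ ⦃u v : V⦄, G.Adj u v → c u ≠ c v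

/-- An `L`-recoloring schedule from `α` to `β` of length `ℓ`: a sequence of `L`-colorings
`X 0 = α, …, X ℓ = β` such that at each step the set of vertices that change color is an
independent set. -/
def IsLRecolorSchedule {V : Type*} (G : SimpleGraph V) (L : V → Finset ℕ) (α β : V → ℕ)
    (ℓ : ℕ) (X : ℕ → V → ℕ) : Prop :=
  X 0 = α ∧ X ℓ = β ∧ (∀ i ≤ ℓ, IsLColoring G L (X i)) ∧
  ∀ i, 1 ≤ i → i ≤ ℓ → ∀ ⦃u v : V⦄, G.Adj u v → X (i - 1) u = X i u ∨ X (i - 1) v = X i v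

namespace TreeRecoloring

/-- Every neighbor of a vertex of a rooted tree is either its parent or one of its children. -/
lemma exists_parent {V : Type*} {G : SimpleGraph V} (hG : G.IsTree) (r : V) :
    ∃ p : V → V, (∀ v, v ≠ r → G.Adj (p v) v ∧ G.dist r v = G.dist r (p v) + 1) ∧
      ∀ u v, G.Adj u v → (v ≠ r ∧ u = p v) ∨ (u ≠ r ∧ v = p u) := by
  have key : ∀ v, ∃ w, (v ≠ r → G.Adj w v ∧ G.dist r v = G.dist r w + 1) ∧
      ∀ u, G.Adj u v → G.dist r v = G.dist r u + 1 → u = w := by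
    intro v
    obtain ⟨P, hP, hlen⟩ := hG.connected.exists_path_of_dist r v
    have uniq : ∀ u, G.Adj u v → G.dist r v = G.dist r u + 1 → u = P.penultimate := by
      intro u huv hd
      obtain ⟨Q, hQ, hQlen⟩ := hG.connected.exists_path_of_dist r u
      have hc : (Q.concat huv).IsPath := by
        apply Walk.isPath_of_length_eq_dist
        rw [Walk.length_concat, hQlen, hd]
      rw [(hG.existsUnique_path r v).unique hP hc, Walk.penultimate_concat]
    refine ⟨P.penultimate, fun hv => ?_, uniq⟩
    have hnil : ¬ P.Nil := fun h => hv h.eq.symm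
    have hadj := P.adj_penultimate hnil
    rcases hG.dist_eq_dist_add_one_of_adj r hadj with h | h
    · have h1 := dist_le (P.dropLast)
      have h2 : P.dropLast.length + 1 = P.length := by
        simpa using Walk.length_dropLast_add_one hnil
      omega
    · exact ⟨hadj, h⟩
  choose p hp1 hp2 using key
  refine ⟨p, hp1, fun u v huv => ?_⟩
  rcases hG.dist_eq_dist_add_one_of_adj r huv with h | h
  · refine Or.inr ⟨?_, hp2 u v huv.symm h⟩
    rintro rfl
    simp at h
  · refine Or.inl ⟨?_, hp2 v u huv h⟩
    rintro rfl
    simp at h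

/-- Heavy-path decomposition: each vertex `u` has a heavy child `hc u`, and every other child
has at most half as many descendants as `u`. -/
lemma exists_heavy_child {V : Type*} [Fintype V] (r : V) (p : V → V) (depth : V → ℕ)
    (hdepth : ∀ v, v ≠ r → depth v = depth (p v) + 1) :
    ∃ (hc : V → V) (size : V → ℕ), size r ≤ Fintype.card V ∧ (∀ v, 1 ≤ size v) ∧
      (∀ v, v ≠ r → size v ≤ size (p v)) ∧
      ∀ v, v ≠ r → hc (p v) ≠ v → 2 * size v ≤ size (p v) := by
  classical
  let desc : V → Finset V := fun v => {w | ∃ k, p^[k] w = v ∧ depth w = depth v + k}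
  have hsub : ∀ v, v ≠ r → desc v ⊆ desc (p v) := by
    intro v hv w hw
    simp only [desc, Finset.mem_filter, Finset.mem_univ, true_and] at hw ⊢
    obtain ⟨k, hk, hd⟩ := hw
    refine ⟨k + 1, by rw [Function.iterate_succ_apply', hk], ?_⟩
    have := hdepth v hv
    omega
  have hdisj : ∀ v w, v ≠ w → depth v = depth w → Disjoint (desc v) (desc w) := by
    intro v w hvw hd
    rw [Finset.disjoint_left]
    intro x hx hy
    simp only [desc, Finset.mem_filter, Finset.mem_univ, true_and] at hx hy
    obtain ⟨k, hk, hkd⟩ := hx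
    obtain ⟨l, hl, hld⟩ := hy
    have : k = l := by omega
    subst this
    exact hvw (hk.symm.trans hl)
  have hheavy : ∀ u, ∃ h, ∀ v, v ≠ r → p v = u →
      h ≠ r ∧ p h = u ∧ (desc v).card ≤ (desc h).card := by
    intro u
    by_cases hne : ∃ v, v ≠ r ∧ p v = u
    · obtain ⟨v, hv⟩ := hne
      obtain ⟨h, hh, hmax⟩ := Finset.exists_max_image
        (Finset.univ.filter fun v => v ≠ r ∧ p v = u) (fun v => (desc v).card) ⟨v, by simp [hv]⟩
      simp only [Finset.mem_filter, Finset.mem_univ, true_and] at hh hmax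
      exact ⟨h, fun w hw hpw => ⟨hh.1, hh.2, hmax w ⟨hw, hpw⟩⟩⟩
    · exact ⟨u, fun v hv hpv => (hne ⟨v, hv, hpv⟩).elim⟩
  choose hc hhc using hheavy
  refine ⟨hc, fun v => (desc v).card, Finset.card_le_univ _, fun v => ?_,
    fun v hv => Finset.card_le_card (hsub v hv), fun v hv hne => ?_⟩
  · exact Finset.card_pos.2 ⟨v, Finset.mem_filter.2 ⟨Finset.mem_univ v, 0, rfl, rfl⟩⟩
  · obtain ⟨h1, h2, h3⟩ := hhc (p v) v hv rfl
    have hd : depth v = depth (hc (p v)) := by rw [hdepth v hv, hdepth _ h1, h2]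
    have hu : desc v ∪ desc (hc (p v)) ⊆ desc (p v) := by
      refine Finset.union_subset (hsub v hv) ?_
      have := hsub _ h1
      rwa [h2] at this
    have hcard := Finset.card_le_card hu
    rw [Finset.card_union_of_disjoint (hdisj _ _ (Ne.symm hne) hd)] at hcard
    simp only
    omega

/-- Dependent choices along a rooted tree, from the root downwards. -/
lemma exists_forall_parent {V D : Type*} (r : V) (p : V → V) (depth : V → ℕ)
    (hdepth : ∀ v, v ≠ r → depth v = depth (p v) + 1) (P : V → D → Prop) (R : V → D → D → Prop)
    (hroot : ∃ d, P r d) (hstep : ∀ v, v ≠ r → ∀ d, P (p v) d → ∃ d', P v d' ∧ R v d d') :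
    ∃ t : V → D, (∀ v, P v (t v)) ∧ ∀ v, v ≠ r → R v (t (p v)) (t v) := by
  classical
  obtain ⟨d₀, hd₀⟩ := hroot
  have hstep' : ∀ v d, ∃ d', v ≠ r → P (p v) d → P v d' ∧ R v d d' := by
    intro v d
    by_cases h : v ≠ r ∧ P (p v) d
    · obtain ⟨d', hd'⟩ := hstep v h.1 d h.2
      exact ⟨d', fun _ _ => hd'⟩
    · exact ⟨d, fun h1 h2 => (h ⟨h1, h2⟩).elim⟩
  choose f hf using hstep'
  let F : ℕ → V → D := fun n => Nat.rec (fun _ => d₀)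
    (fun _ g v => if v = r then d₀ else f v (g (p v))) n
  have hF : ∀ n v, F (n + 1) v = if v = r then d₀ else f v (F n (p v)) := fun _ _ => rfl
  let t : V → D := fun v => F (depth v + 1) v
  have htr : t r = d₀ := by simp [t, hF]
  have ht : ∀ v, v ≠ r → t v = f v (t (p v)) := by
    intro v hv
    simp only [t]
    rw [hF, if_neg hv, hdepth v hv]
  have hP : ∀ n v, depth v = n → P v (t v) := by
    intro n
    induction n with
    | zero =>
      intro v hv
      by_cases h : v = r
      · rw [h, htr]; exact hd₀
      · have := hdepth v h
        omega
    | succ n ih =>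
      intro v hv
      by_cases h : v = r
      · rw [h, htr]; exact hd₀
      · have h' := hdepth v h
        rw [ht v h]
        exact (hf v _ h (ih (p v) (by omega))).1
  refine ⟨t, fun v => hP _ v rfl, fun v hv => ?_⟩
  rw [ht v hv]
  exact (hf v _ hv (hP _ (p v) rfl)).2

lemma exists_mem_avoiding_three {s : Finset ℕ} (hs : 4 ≤ s.card) (x y z : ℕ) :
    ∃ c ∈ s, c ≠ x ∧ c ≠ y ∧ c ≠ z := by
  have h : ({x, y, z} : Finset ℕ).card < s.card := lt_of_le_of_lt Finset.card_le_three hs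
  obtain ⟨c, hc, hn⟩ := Finset.exists_mem_notMem_of_card_lt_card h
  simp only [Finset.mem_insert, Finset.mem_singleton, not_or] at hn
  exact ⟨c, hc, hn⟩

/-- The color at time `t` of a vertex that starts with color `c₀` and takes the color `cᵢ`
at time `tᵢ`. -/
def stagedColor (t₁ t₂ t₃ t₄ c₀ c₁ c₂ c₃ c₄ t : ℕ) : ℕ :=
  if t < t₁ then c₀ else if t < t₂ then c₁ else if t < t₃ then c₂ else if t < t₄ then c₃ else c₄

lemma stagedColor_mem {s : Finset ℕ} {t₁ t₂ t₃ t₄ c₀ c₁ c₂ c₃ c₄ t : ℕ} (h₀ : c₀ ∈ s)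
    (h₁ : c₁ ∈ s) (h₂ : c₂ ∈ s) (h₃ : c₃ ∈ s) (h₄ : c₄ ∈ s) :
    stagedColor t₁ t₂ t₃ t₄ c₀ c₁ c₂ c₃ c₄ t ∈ s := by
  unfold stagedColor
  split_ifs <;> assumption

lemma stagedColor_pred {t₁ t₂ t₃ t₄ c₀ c₁ c₂ c₃ c₄ t : ℕ} (ht : 1 ≤ t) (h₁ : t ≠ t₁)
    (h₂ : t ≠ t₂) (h₃ : t ≠ t₃) (h₄ : t ≠ t₄) :
    stagedColor t₁ t₂ t₃ t₄ c₀ c₁ c₂ c₃ c₄ (t - 1) = stagedColor t₁ t₂ t₃ t₄ c₀ c₁ c₂ c₃ c₄ t := by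
  have e : ∀ s, t ≠ s → (t - 1 < s ↔ t < s) := fun s hs => by omega
  simp only [stagedColor, e _ h₁, e _ h₂, e _ h₃, e _ h₄]

/-- The recoloring plan of a vertex: the layer of its heavy path, the parity of its position on
the heavy path, the three intermediate colors, and the first and last intermediate colors
promised to its heavy child. -/
structure Plan where
  layer : ℕ
  odd : Bool
  fst : ℕ
  mid : ℕ
  lst : ℕ
  nextFst : ℕ
  nextLst : ℕ

/-- The requirements on the plan of a single vertex `v`. -/
structure Plan.Valid {V : Type*} (L : V → Finset ℕ) (α β : V → ℕ) (hc : V → V) (size : V → ℕ)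
    (n : ℕ) (v : V) (d : Plan) : Prop where
  size_le : 2 ^ d.layer * size v ≤ n
  fst_mem : d.fst ∈ L v
  mid_mem : d.mid ∈ L v
  lst_mem : d.lst ∈ L v
  nextFst_mem : d.nextFst ∈ L (hc v)
  nextLst_mem : d.nextLst ∈ L (hc v)
  nextFst_ne : d.nextFst ≠ d.fst ∧ d.nextFst ≠ α v ∧ d.nextFst ≠ α (hc (hc v))
  nextLst_ne : d.nextLst ≠ d.lst ∧ d.nextLst ≠ β v ∧ d.nextLst ≠ β (hc (hc v))
  fst_ne : d.odd = true → d.fst ≠ α (hc v)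
  lst_ne : d.odd = true → d.lst ≠ β (hc v)
  mid_ne : d.mid ≠ if d.odd then d.nextLst else d.nextFst

/-- The plan `d'` of the heavy child fits the plan `d` of its parent. -/
structure Plan.Heavy (d d' : Plan) : Prop where
  layer_eq : d'.layer = d.layer
  odd_eq : d'.odd = !d.odd
  fst_eq : d'.fst = d.nextFst
  lst_eq : d'.lst = d.nextLst
  mid_ne : d'.mid ≠ d.mid ∧ d'.mid ≠ if d'.odd then d.lst else d.fst

/-- The plan `d'` of a child other than the heavy one fits the plan `d` of its parent, whose
initial and final colors are `a` and `b`. -/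
structure Plan.Light (a b : ℕ) (d d' : Plan) : Prop where
  layer_eq : d'.layer = d.layer + 1
  odd_eq : d'.odd = false
  fst_ne : d'.fst ≠ a ∧ d'.fst ≠ d.fst ∧ d'.fst ≠ d.mid
  lst_ne : d'.lst ≠ b ∧ d'.lst ≠ d.lst ∧ d'.lst ≠ d.mid
  mid_ne : d'.mid ≠ d.mid

lemma Plan.exists_valid_heavy {V : Type*} {L : V → Finset ℕ} (hL : ∀ v, 4 ≤ (L v).card)
    {α β : V → ℕ} {hc : V → V} {size : V → ℕ} {n : ℕ} {u v : V} {d : Plan}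
    (hd : d.Valid L α β hc size n u) (hv : hc u = v) (hs : size v ≤ size u) :
    ∃ d' : Plan, d'.Valid L α β hc size n v ∧ d.Heavy d' := by
  subst hv
  obtain ⟨a, ha, ha'⟩ :=
    exists_mem_avoiding_three (hL (hc (hc u))) d.nextFst (α (hc u)) (α (hc (hc (hc u))))
  obtain ⟨b, hb, hb'⟩ :=
    exists_mem_avoiding_three (hL (hc (hc u))) d.nextLst (β (hc u)) (β (hc (hc (hc u))))
  obtain ⟨c, hcm, h1, h2, h3⟩ := exists_mem_avoiding_three (hL (hc u)) d.mid
    (if !d.odd then d.lst else d.fst) (if !d.odd then b else a)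
  exact ⟨⟨d.layer, !d.odd, d.nextFst, c, d.nextLst, a, b⟩,
    { size_le := (Nat.mul_le_mul_left _ hs).trans hd.size_le
      fst_mem := hd.nextFst_mem
      mid_mem := hcm
      lst_mem := hd.nextLst_mem
      nextFst_mem := ha
      nextLst_mem := hb
      nextFst_ne := ha'
      nextLst_ne := hb'
      fst_ne := fun _ => hd.nextFst_ne.2.2
      lst_ne := fun _ => hd.nextLst_ne.2.2
      mid_ne := h3 }, ⟨rfl, rfl, rfl, rfl, h1, h2⟩⟩

/-- A plan for the first vertex of a heavy path, avoiding prescribed colors. -/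
lemma Plan.exists_valid_head {V : Type*} {L : V → Finset ℕ} (hL : ∀ v, 4 ≤ (L v).card)
    {α β : V → ℕ} {hc : V → V} {size : V → ℕ} {n : ℕ} {v : V} (k a b : ℕ) (d : Plan)
    (hs : 2 ^ k * size v ≤ n) :
    ∃ d' : Plan, d'.Valid L α β hc size n v ∧ d'.layer = k ∧ d'.odd = false ∧
      (d'.fst ≠ a ∧ d'.fst ≠ d.fst ∧ d'.fst ≠ d.mid) ∧
      (d'.lst ≠ b ∧ d'.lst ≠ d.lst ∧ d'.lst ≠ d.mid) ∧ d'.mid ≠ d.mid := by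
  obtain ⟨x, hx, hx'⟩ := exists_mem_avoiding_three (hL v) a d.fst d.mid
  obtain ⟨y, hy, hy'⟩ := exists_mem_avoiding_three (hL v) b d.lst d.mid
  obtain ⟨nx, hnx, hnx'⟩ := exists_mem_avoiding_three (hL (hc v)) x (α v) (α (hc (hc v)))
  obtain ⟨ny, hny, hny'⟩ := exists_mem_avoiding_three (hL (hc v)) y (β v) (β (hc (hc v)))
  obtain ⟨c, hcm, h1, h2, -⟩ := exists_mem_avoiding_three (hL v) d.mid nx nx
  exact ⟨⟨k, false, x, c, y, nx, ny⟩,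
    { size_le := hs
      fst_mem := hx
      mid_mem := hcm
      lst_mem := hy
      nextFst_mem := hnx
      nextLst_mem := hny
      nextFst_ne := hnx'
      nextLst_ne := hny'
      fst_ne := fun h => by simp at h
      lst_ne := fun h => by simp at h
      mid_ne := by simpa using h2 }, rfl, rfl, hx', hy', h1⟩

/-- The first intermediate colors are taken from the deepest layer upwards, the second ones from
the top layer downwards, the third ones upwards, and the final ones downwards. -/
def Plan.color (H a b : ℕ) (d : Plan) : ℕ → ℕ :=
  stagedColor (2 * (H - 1 - d.layer) + 1 + (if d.odd then 0 else 1))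
    (2 * H + 2 * d.layer + 1 + (if d.odd then 1 else 0))
    (4 * H + 2 * (H - 1 - d.layer) + 1 + (if d.odd then 1 else 0))
    (6 * H + 2 * d.layer + 1 + (if d.odd then 1 else 0)) a d.fst d.mid d.lst b

lemma stagedColor_pred_or {t₁ t₂ t₃ t₄ c₀ c₁ c₂ c₃ c₄ s₁ s₂ s₃ s₄ d₀ d₁ d₂ d₃ d₄ t : ℕ}
    (ht : 1 ≤ t) (h : (t ≠ t₁ ∧ t ≠ t₂ ∧ t ≠ t₃ ∧ t ≠ t₄) ∨ (t ≠ s₁ ∧ t ≠ s₂ ∧ t ≠ s₃ ∧ t ≠ s₄)) :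
    stagedColor t₁ t₂ t₃ t₄ c₀ c₁ c₂ c₃ c₄ (t - 1) = stagedColor t₁ t₂ t₃ t₄ c₀ c₁ c₂ c₃ c₄ t ∨
      stagedColor s₁ s₂ s₃ s₄ d₀ d₁ d₂ d₃ d₄ (t - 1) =
        stagedColor s₁ s₂ s₃ s₄ d₀ d₁ d₂ d₃ d₄ t := by
  rcases h with ⟨h₁, h₂, h₃, h₄⟩ | ⟨h₁, h₂, h₃, h₄⟩
  · exact Or.inl (stagedColor_pred ht h₁ h₂ h₃ h₄)
  · exact Or.inr (stagedColor_pred ht h₁ h₂ h₃ h₄)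

lemma Plan.color_light {H a b a' b' : ℕ} {d d' : Plan} (ha : a ≠ a') (hb : b ≠ b')
    (h : d.Light a b d') (hd : d'.layer < H) (t : ℕ) :
    d.color H a b t ≠ d'.color H a' b' t ∧ (1 ≤ t →
      d.color H a b (t - 1) = d.color H a b t ∨ d'.color H a' b' (t - 1) = d'.color H a' b' t) := by
  obtain ⟨h1, h2, ⟨h3, h4, h5⟩, ⟨h6, h7, h8⟩, h9⟩ := h
  obtain ⟨l, o, x, y, z, nx, ny⟩ := d
  obtain ⟨l', o', x', y', z', nx', ny'⟩ := d'
  simp only at h1 h2 h3 h4 h5 h6 h7 h8 h9 hd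
  subst h1 h2
  have ho : (if o then 0 else 1) + (if o then 1 else 0) = 1 := by cases o <;> rfl
  simp only [Plan.color]
  generalize (if o then 0 else 1) = e at *
  generalize (if o then 1 else 0) = e' at *
  simp only [Bool.false_eq_true, if_false]
  constructor
  · unfold stagedColor
    split_ifs <;> omega
  · intro ht
    apply stagedColor_pred_or ht
    omega

lemma Plan.color_heavy {H a b a' b' : ℕ} {d d' : Plan} (ha : a ≠ a') (hb : b ≠ b')
    (h : d.Heavy d') (hd : d'.layer < H)
    (hf : d'.fst ≠ d.fst ∧ d'.fst ≠ a) (hl : d'.lst ≠ d.lst ∧ d'.lst ≠ b)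
    (hf' : d.odd = true → d.fst ≠ a') (hl' : d.odd = true → d.lst ≠ b')
    (hm : d.mid ≠ if d.odd then d'.lst else d'.fst) (t : ℕ) :
    d.color H a b t ≠ d'.color H a' b' t ∧ (1 ≤ t →
      d.color H a b (t - 1) = d.color H a b t ∨ d'.color H a' b' (t - 1) = d'.color H a' b' t) := by
  obtain ⟨h1, h2, h3, h4, h5, h6⟩ := h
  obtain ⟨l, o, x, y, z, nx, ny⟩ := d
  obtain ⟨l', o', x', y', z', nx', ny'⟩ := d'
  simp only at h1 h2 h3 h4 h5 h6 hd hf hl hf' hl' hm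
  subst h1 h2
  simp only [Plan.color]
  constructor
  · unfold stagedColor
    cases o <;>
      simp only [Bool.not_true, Bool.not_false, Bool.false_eq_true, if_true, if_false,
        forall_const] at hf' hl' hm h6 ⊢ <;>
      split_ifs <;> omega
  · intro ht
    apply stagedColor_pred_or ht
    cases o <;>
      simp only [Bool.not_true, Bool.not_false, Bool.false_eq_true, if_true, if_false] <;>
      omega

end TreeRecoloring

open TreeRecoloring

/-- List-recoloring of trees with lists of size at least 4: a schedule of length `O(log n)`
always exists. -/
theorem stmt_9 :
    ∃ C : ℝ, ∀ (V : Type) [Fintype V] (G : SimpleGraph V), G.IsTree → 2 ≤ Fintype.card V →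
      ∀ L : V → Finset ℕ, (∀ v, 4 ≤ (L v).card) →
      ∀ α β : V → ℕ, IsLColoring G L α → IsLColoring G L β →
      ∃ (ℓ : ℕ) (X : ℕ → V → ℕ), IsLRecolorSchedule G L α β ℓ X ∧
        (ℓ : ℝ) ≤ C * Real.logb 2 (Fintype.card V) := by
  refine ⟨16, fun V _ G hG hn L hL α β hα hβ => ?_⟩
  classical
  obtain ⟨r⟩ := hG.connected.nonempty
  obtain ⟨p, hp, hadj⟩ := exists_parent hG r
  have hpadj := fun v hv => (hp v hv).1
  have hdepth := fun v hv => (hp v hv).2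
  obtain ⟨hc, size, hsr, hs1, hsp, hslight⟩ := exists_heavy_child r p (G.dist r) hdepth
  set n := Fintype.card V with hn_def
  obtain ⟨D, hD, hR⟩ := exists_forall_parent r p (G.dist r) hdepth
    (Plan.Valid L α β hc size n)
    (fun v d d' => (hc (p v) = v ∧ d.Heavy d') ∨ d.Light (α (p v)) (β (p v)) d')
    (by
      obtain ⟨d, hd, -⟩ := Plan.exists_valid_head (α := α) (β := β) (hc := hc) (size := size)
        (n := n) (v := r) hL 0 0 0 ⟨0, false, 0, 0, 0, 0, 0⟩ (by simpa using hsr)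
      exact ⟨d, hd⟩)
    (by
      intro v hv d hd
      by_cases hh : hc (p v) = v
      · obtain ⟨d', h1, h2⟩ := Plan.exists_valid_heavy hL hd hh (hsp v hv)
        exact ⟨d', h1, Or.inl ⟨hh, h2⟩⟩
      · have hle : 2 ^ (d.layer + 1) * size v ≤ n := by
          refine le_trans ?_ hd.size_le
          rw [pow_succ, mul_assoc]
          exact Nat.mul_le_mul_left _ (hslight v hv hh)
        obtain ⟨d', h1, h2, h3, h4, h5, h6⟩ := Plan.exists_valid_head (α := α) (β := β) (hc := hc)
          hL (d.layer + 1) (α (p v)) (β (p v)) d hle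
        exact ⟨d', h1, Or.inr ⟨h2, h3, h4, h5, h6⟩⟩)
  set H := Nat.log 2 n + 1 with hH
  have hlayer : ∀ v, (D v).layer < H := by
    intro v
    have h1 : 2 ^ (D v).layer ≤ n :=
      (Nat.le_mul_of_pos_right _ (hs1 v)).trans (hD v).size_le
    exact Nat.lt_succ_of_le (Nat.le_log_of_pow_le (by norm_num) h1)
  let X : ℕ → V → ℕ := fun t v => (D v).color H (α v) (β v) t
  have hparent : ∀ v, v ≠ r → ∀ t, X t (p v) ≠ X t v ∧
      (1 ≤ t → X (t - 1) (p v) = X t (p v) ∨ X (t - 1) v = X t v) := by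
    intro v hv t
    have hpv := hpadj v hv
    rcases hR v hv with ⟨hh, h⟩ | h
    · have hP := hD (p v)
      refine Plan.color_heavy (hα.2 hpv) (hβ.2 hpv) h (hlayer v) ?_ ?_ ?_ ?_ ?_ t
      · rw [h.fst_eq]; exact ⟨hP.nextFst_ne.1, hP.nextFst_ne.2.1⟩
      · rw [h.lst_eq]; exact ⟨hP.nextLst_ne.1, hP.nextLst_ne.2.1⟩
      · simpa only [hh] using hP.fst_ne
      · simpa only [hh] using hP.lst_ne
      · rw [h.fst_eq, h.lst_eq]; exact hP.mid_ne
    · exact Plan.color_light (hα.2 hpv) (hβ.2 hpv) h (hlayer v) t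
  have hedge : ∀ u v, G.Adj u v → ∀ t, X t u ≠ X t v ∧
      (1 ≤ t → X (t - 1) u = X t u ∨ X (t - 1) v = X t v) := by
    intro u v huv t
    rcases hadj u v huv with ⟨hv, rfl⟩ | ⟨hu, rfl⟩
    · exact hparent v hv t
    · exact ⟨(hparent u hu t).1.symm, fun ht => ((hparent u hu t).2 ht).symm⟩
  refine ⟨8 * H, X, ⟨?_, ?_, fun t _ => ⟨fun v => ?_, fun u v huv => (hedge u v huv t).1⟩,
    fun t ht _ u v huv => (hedge u v huv t).2 ht⟩, ?_⟩
  · funext v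
    simp [X, Plan.color, stagedColor]
  · funext v
    have := hlayer v
    have ho : (if (D v).odd then 1 else 0) ≤ 1 := by split_ifs <;> simp
    have ho' : (if (D v).odd then 0 else 1) ≤ 1 := by split_ifs <;> simp
    simp only [X, Plan.color, stagedColor]
    rw [if_neg (by omega), if_neg (by omega), if_neg (by omega), if_neg (by omega)]
  · exact stagedColor_mem (hα.1 v) (hD v).fst_mem (hD v).mid_mem (hD v).lst_mem (hβ.1 v)
  · have h1 : (Nat.log 2 n : ℝ) ≤ Real.logb 2 n := by exact_mod_cast Real.natLog_le_logb n 2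
    have h2 : (1 : ℝ) ≤ Real.logb 2 n := by
      rw [Real.le_logb_iff_rpow_le (by norm_num) (by positivity)]
      simpa using (by exact_mod_cast hn : (2 : ℝ) ≤ n)
    rw [hH]
    push_cast
    linarith
end

section
/- There is an absolute constant C such that for every finite simple graph G on n ≥ 2 vertices with maximum degree at most 3 and any two proper 3-colorings s and t of G, there exists a recoloring schedule from s to t of length at most C·log₂ n using colors {1,2,3,4}. -/
open SimpleGraph

/-- A proper `m`-coloring: colors in `{1,…,m}`, adjacent vertices get distinct colors. -/
def IsProperColoring {V : Type*} (G : SimpleGraph V) (m : ℕ) (x : V → ℕ) : Prop :=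
  (∀ v, x v ∈ Finset.Icc 1 m) ∧ ∀ ⦃u v : V⦄, G.Adj u v → x u ≠ x v

/-- A recoloring schedule from `s` to `t` of length `ℓ` using colors `{1,…,m}`:
a sequence of proper `m`-colorings `X 0 = s, …, X ℓ = t` such that at each step the set of
vertices that change color is an independent set. -/
def IsRecolorSchedule {V : Type*} (G : SimpleGraph V) (m : ℕ) (s t : V → ℕ)
    (ℓ : ℕ) (X : ℕ → V → ℕ) : Prop :=
  X 0 = s ∧ X ℓ = t ∧ (∀ i ≤ ℓ, IsProperColoring G m (X i)) ∧
  ∀ i, 1 ≤ i → i ≤ ℓ → ∀ ⦃u v : V⦄, G.Adj u v → X (i - 1) u = X i u ∨ X (i - 1) v = X i v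

/-- Every vertex has at most three neighbors. -/
def Subcubic {V : Type*} (G : SimpleGraph V) : Prop :=
  ∀ ⦃v a b c d : V⦄, G.Adj v a → G.Adj v b → G.Adj v c → G.Adj v d →
    a = b ∨ a = c ∨ a = d ∨ b = c ∨ b = d ∨ c = d

/-- The subgraph induced by `Q` is connected, expressed through cuts. -/
def CutConnected {V : Type*} (G : SimpleGraph V) (Q : Finset V) : Prop :=
  ∀ X ⊆ Q, X.Nonempty → X ≠ Q → ∃ x ∈ X, ∃ y ∈ Q, y ∉ X ∧ G.Adj x y

/-- The subgraph induced by `Q` is 2-edge-connected, expressed through cuts. -/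
def CutTwoConnected {V : Type*} (G : SimpleGraph V) (Q : Finset V) : Prop :=
  ∀ X ⊆ Q, X.Nonempty → X ≠ Q → ∃ x ∈ X, ∃ y ∈ Q, ∃ x' ∈ X, ∃ y' ∈ Q,
    y ∉ X ∧ y' ∉ X ∧ G.Adj x y ∧ G.Adj x' y' ∧ (x ≠ x' ∨ y ≠ y')

section Connectivity

variable {V : Type*} {G : SimpleGraph V}

theorem CutTwoConnected.cutConnected {Q : Finset V} (h : CutTwoConnected G Q) :
    CutConnected G Q := by
  intro X hX hne hXQ
  obtain ⟨x, hx, y, hy, -, -, -, -, hyX, -, hxy, -⟩ := h X hX hne hXQ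
  exact ⟨x, hx, y, hy, hyX, hxy⟩

theorem cutConnected_singleton (x : V) : CutConnected G {x} := by
  intro X hX hne hXQ
  rcases Finset.subset_singleton_iff.1 hX with h | h
  · exact absurd h hne.ne_empty
  · exact absurd h hXQ

theorem cutTwoConnected_singleton (x : V) : CutTwoConnected G {x} := by
  intro X hX hne hXQ
  rcases Finset.subset_singleton_iff.1 hX with h | h
  · exact absurd h hne.ne_empty
  · exact absurd h hXQ

theorem exists_maximal_subset (P : Finset V → Prop) {D B : Finset V} (hD : P D) (hDB : D ⊆ B) :
    ∃ D' ⊆ B, P D' ∧ ∀ E ⊆ B, D' ⊆ E → P E → E = D' := by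
  classical
  obtain ⟨D', hD', hmax⟩ := Finset.exists_max_image (B.powerset.filter P) Finset.card
    ⟨D, by simp [hD, hDB]⟩
  simp only [Finset.mem_filter, Finset.mem_powerset] at hD' hmax
  refine ⟨D', hD'.1, hD'.2, fun E hE hDE hPE => ?_⟩
  exact (Finset.eq_of_subset_of_card_le hDE (hmax E ⟨hE, hPE⟩)).symm

theorem CutTwoConnected.exists_two_adj {Q : Finset V} (h : CutTwoConnected G Q) {x y : V}
    (hx : x ∈ Q) (hy : y ∈ Q) (hxy : x ≠ y) :
    ∃ a ∈ Q, ∃ b ∈ Q, a ≠ b ∧ G.Adj x a ∧ G.Adj x b := by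
  obtain ⟨u, hu, a, ha, u', hu', b, hb, h1, h2, h3, h4, h5⟩ := h {x} (by simpa using hx) (by simp)
    (fun he => by rw [← he] at hy; exact hxy (Finset.mem_singleton.1 hy).symm)
  simp only [Finset.mem_singleton] at hu hu'
  subst hu hu'
  exact ⟨a, ha, b, hb, by simpa using h5, h3, h4⟩

variable [DecidableEq V]

theorem CutConnected.insert_adj {Q : Finset V} (h : CutConnected G Q) {x y : V} (hx : x ∈ Q)
    (hxy : G.Adj x y) : CutConnected G (insert y Q) := by
  intro X hX hne hXQ
  by_cases h1 : X ∩ Q = ∅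
  · have hXy : X = {y} := by
      apply Finset.Nonempty.subset_singleton_iff hne |>.1
      intro z hz
      have := hX hz
      have hzQ : z ∉ Q := fun hq => by
        have : z ∈ X ∩ Q := Finset.mem_inter.2 ⟨hz, hq⟩
        simp [h1] at this
      simpa [hzQ] using this
    subst hXy
    refine ⟨y, by simp, x, by simp [hx], ?_, hxy.symm⟩
    simpa using hxy.ne
  by_cases h2 : X ∩ Q = Q
  · have hQX : Q ⊆ X := Finset.inter_eq_right.1 h2
    have hyX : y ∉ X := fun hy => hXQ (Finset.Subset.antisymm hX
      (Finset.insert_subset hy hQX))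
    exact ⟨x, hQX hx, y, by simp, hyX, hxy⟩
  · obtain ⟨a, ha, b, hb, hbX, hab⟩ := h (X ∩ Q) Finset.inter_subset_right
      (Finset.nonempty_iff_ne_empty.2 h1) h2
    exact ⟨a, (Finset.mem_inter.1 ha).1, b, by simp [hb], fun hbX' => hbX (by simp [hb, hbX']), hab⟩

theorem CutConnected.union {A B : Finset V} (hA : CutConnected G A) (hB : CutConnected G B)
    {x : V} (hxA : x ∈ A) (hxB : x ∈ B) : CutConnected G (A ∪ B) := by
  intro X hX hne hXQ
  by_cases h1 : (X ∩ A).Nonempty ∧ X ∩ A ≠ A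
  · obtain ⟨a, ha, b, hb, hbX, hab⟩ := hA (X ∩ A) Finset.inter_subset_right h1.1 h1.2
    grind
  by_cases h2 : (X ∩ B).Nonempty ∧ X ∩ B ≠ B
  · obtain ⟨a, ha, b, hb, hbX, hab⟩ := hB (X ∩ B) Finset.inter_subset_right h2.1 h2.2
    grind
  exfalso
  by_cases hx : x ∈ X
  · have hA' : X ∩ A = A := by
      by_contra h; exact h1 ⟨⟨x, by simp [hx, hxA]⟩, h⟩
    have hB' : X ∩ B = B := by
      by_contra h; exact h2 ⟨⟨x, by simp [hx, hxB]⟩, h⟩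
    exact hXQ (Finset.Subset.antisymm hX
      (Finset.union_subset (Finset.inter_eq_right.1 hA') (Finset.inter_eq_right.1 hB')))
  · obtain ⟨z, hz⟩ := hne
    rcases Finset.mem_union.1 (hX hz) with hz' | hz'
    · exact h1 ⟨⟨z, by simp [hz, hz']⟩, fun h => hx (Finset.inter_eq_right.1 h hxA)⟩
    · exact h2 ⟨⟨z, by simp [hz, hz']⟩, fun h => hx (Finset.inter_eq_right.1 h hxB)⟩

theorem CutTwoConnected.union {A B : Finset V} (hA : CutTwoConnected G A)
    (hB : CutTwoConnected G B) {x : V} (hxA : x ∈ A) (hxB : x ∈ B) :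
    CutTwoConnected G (A ∪ B) := by
  intro X hX hne hXQ
  by_cases h1 : (X ∩ A).Nonempty ∧ X ∩ A ≠ A
  · obtain ⟨a, ha, b, hb, c, hc, d, hd, h⟩ := hA (X ∩ A) Finset.inter_subset_right h1.1 h1.2
    exact ⟨a, by grind, b, by grind, c, by grind, d, by grind, by grind⟩
  by_cases h2 : (X ∩ B).Nonempty ∧ X ∩ B ≠ B
  · obtain ⟨a, ha, b, hb, c, hc, d, hd, h⟩ := hB (X ∩ B) Finset.inter_subset_right h2.1 h2.2
    exact ⟨a, by grind, b, by grind, c, by grind, d, by grind, by grind⟩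
  exfalso
  by_cases hx : x ∈ X
  · have hA' : X ∩ A = A := by
      by_contra h; exact h1 ⟨⟨x, by simp [hx, hxA]⟩, h⟩
    have hB' : X ∩ B = B := by
      by_contra h; exact h2 ⟨⟨x, by simp [hx, hxB]⟩, h⟩
    exact hXQ (Finset.Subset.antisymm hX
      (Finset.union_subset (Finset.inter_eq_right.1 hA') (Finset.inter_eq_right.1 hB')))
  · obtain ⟨z, hz⟩ := hne
    rcases Finset.mem_union.1 (hX hz) with hz' | hz'
    · exact h1 ⟨⟨z, by simp [hz, hz']⟩, fun h => hx (Finset.inter_eq_right.1 h hxA)⟩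
    · exact h2 ⟨⟨z, by simp [hz, hz']⟩, fun h => hx (Finset.inter_eq_right.1 h hxB)⟩

theorem CutTwoConnected.erase {Q : Finset V} (hG : Subcubic G) (h : CutTwoConnected G Q) (x : V) :
    CutConnected G (Q.erase x) := by
  by_cases hxQ : x ∈ Q
  swap
  · rw [Finset.erase_eq_of_notMem hxQ]; exact h.cutConnected
  intro X hX hne hXQ
  by_contra hcon
  have hno : ∀ a ∈ X, ∀ b ∈ Q.erase x, b ∉ X → ¬ G.Adj a b := fun a ha b hb hbX hab =>
    hcon ⟨a, ha, b, hb, hbX, hab⟩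
  obtain ⟨x1, hx1, y1, hy1, x2, hx2, y2, hy2, h1, h2, h3, h4, h5⟩ :=
    h X (hX.trans (Finset.erase_subset _ _)) hne (by rintro rfl; simpa using hX hxQ)
  have e1 : y1 = x := by
    by_contra hh; exact hno x1 hx1 y1 (by simp [hh, hy1]) h1 h3
  have e2 : y2 = x := by
    by_contra hh; exact hno x2 hx2 y2 (by simp [hh, hy2]) h2 h4
  have hYne : (Q.erase x \ X).Nonempty := by
    rw [Finset.sdiff_nonempty]
    exact fun hh => hXQ (Finset.Subset.antisymm hX hh)
  obtain ⟨u1, hu1, w1, hw1, u2, hu2, w2, hw2, g1, g2, g3, g4, g5⟩ :=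
    h (Q.erase x \ X) (Finset.sdiff_subset.trans (Finset.erase_subset _ _)) hYne
      (by intro hh; rw [← hh] at hxQ; simp at hxQ)
  simp only [Finset.mem_sdiff] at hu1 hu2 g1 g2
  have e3 : w1 = x := by
    by_contra hh
    exact hno w1 (by_contra fun hX' => g1 ⟨by simp [hh, hw1], hX'⟩) u1 hu1.1 hu1.2 g3.symm
  have e4 : w2 = x := by
    by_contra hh
    exact hno w2 (by_contra fun hX' => g2 ⟨by simp [hh, hw2], hX'⟩) u2 hu2.1 hu2.2 g4.symm
  subst e1
  rw [e2] at h4 h5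
  rw [e3] at g3 g5
  rw [e4] at g4 g5
  have := hG h3.symm h4.symm g3.symm g4.symm
  grind

/-- Attaching a minimal ear keeps 2-edge-connectivity. -/
theorem CutTwoConnected.union_ear {C D : Finset V} {u₁ u₂ c₁ c₂ : V} (hC : CutTwoConnected G C)
    (hD : CutConnected G D) (hdis : Disjoint C D) (hc₁ : c₁ ∈ C) (hc₂ : c₂ ∈ C) (hu₁ : u₁ ∈ D)
    (hu₂ : u₂ ∈ D) (h₁ : G.Adj u₁ c₁) (h₂ : G.Adj u₂ c₂) (hne : u₁ ≠ u₂ ∨ c₁ ≠ c₂)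
    (hmin : ∀ D' ⊆ D, CutConnected G D' → u₁ ∈ D' → u₂ ∈ D' → D' = D) :
    CutTwoConnected G (C ∪ D) := by
  have hCD : ∀ z ∈ C, z ∉ D := fun z hz hz' => Finset.disjoint_left.1 hdis hz hz'
  have key : ∀ X ⊆ D, X.Nonempty → ∃ x ∈ X, ∃ y ∈ C ∪ D, ∃ x' ∈ X, ∃ y' ∈ C ∪ D,
      y ∉ X ∧ y' ∉ X ∧ G.Adj x y ∧ G.Adj x' y' ∧ (x ≠ x' ∨ y ≠ y') := by
    intro X hX hXne
    have hCX : ∀ z ∈ C, z ∉ X := fun z hz hz' => hCD z hz (hX hz')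
    by_cases m1 : u₁ ∈ X
    · by_cases m2 : u₂ ∈ X
      · exact ⟨u₁, m1, c₁, by simp [hc₁], u₂, m2, c₂, by simp [hc₂], hCX _ hc₁, hCX _ hc₂, h₁, h₂,
          hne⟩
      · obtain ⟨x, hx, y, hy, hyX, hxy⟩ := hD X hX hXne (by rintro rfl; exact m2 hu₂)
        exact ⟨u₁, m1, c₁, by simp [hc₁], x, hx, y, by simp [hy], hCX _ hc₁, hyX, h₁, hxy,
          .inr (by rintro rfl; exact hCD _ hc₁ hy)⟩
    · obtain ⟨x, hx, y, hy, hyX, hxy⟩ := hD X hX hXne (by rintro rfl; exact m1 hu₁)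
      by_cases m2 : u₂ ∈ X
      · exact ⟨u₂, m2, c₂, by simp [hc₂], x, hx, y, by simp [hy], hCX _ hc₂, hyX, h₂, hxy,
          .inr (by rintro rfl; exact hCD _ hc₂ hy)⟩
      · by_contra hcon
        have huniq : ∀ x' ∈ X, ∀ y' ∈ D, y' ∉ X → G.Adj x' y' → y' = y := by
          intro x' hx' y' hy' hyX' hadj
          by_contra hyy
          exact hcon ⟨x, hx, y, by simp [hy], x', hx', y', by simp [hy'], hyX, hyX', hxy, hadj,
            .inr (Ne.symm hyy)⟩
        have hDX : CutConnected G (D \ X) := by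
          intro Z hZ hZne hZD
          by_cases hyZ : y ∈ Z
          · have hZ'ne : ((D \ X) \ Z).Nonempty := by
              rw [Finset.sdiff_nonempty]
              exact fun hh => hZD (Finset.Subset.antisymm hZ hh)
            obtain ⟨z, hz, w, hw, hwZ, hzw⟩ := hD ((D \ X) \ Z)
              (Finset.sdiff_subset.trans Finset.sdiff_subset) hZ'ne
              (by intro hh; rw [← hh] at hy; simp [hyZ] at hy)
            have := huniq w
            simp only [Finset.mem_sdiff] at hz hwZ
            have hwX : w ∉ X := fun hwX =>
              hz.2 (by rw [huniq w hwX z hz.1.1 hz.1.2 hzw.symm]; exact hyZ)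
            exact ⟨w, by_contra fun h => hwZ ⟨⟨hw, hwX⟩, h⟩, z, by simp [hz.1], hz.2, hzw.symm⟩
          · obtain ⟨z, hz, w, hw, hwZ, hzw⟩ := hD Z (hZ.trans Finset.sdiff_subset) hZne
              (by rintro rfl; exact hyZ hy)
            have hz' := Finset.mem_sdiff.1 (hZ hz)
            have hwX : w ∉ X := fun hwX =>
              hyZ (by rw [← huniq w hwX z hz'.1 hz'.2 hzw.symm]; exact hz)
            exact ⟨z, hz, w, by simp [hw, hwX], hwZ, hzw⟩
        have := hmin (D \ X) Finset.sdiff_subset hDX (by simp [hu₁, m1]) (by simp [hu₂, m2])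
        rw [← this] at hX
        have := hX hx
        simp [hx] at this
  intro X hX hXne hXQ
  by_cases e1 : X ∩ C = ∅
  · apply key X _ hXne
    intro z hz
    rcases Finset.mem_union.1 (hX hz) with h | h
    · have : z ∈ X ∩ C := by simp [hz, h]
      simp [e1] at this
    · exact h
  by_cases e2 : X ∩ C = C
  · have hCX : C ⊆ X := Finset.inter_eq_right.1 e2
    have hYne : ((C ∪ D) \ X).Nonempty := by
      rw [Finset.sdiff_nonempty]
      exact fun hh => hXQ (Finset.Subset.antisymm hX hh)
    obtain ⟨x, hx, y, hy, x', hx', y', hy', g1, g2, g3, g4, g5⟩ := key ((C ∪ D) \ X) (by grind) hYne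
    simp only [Finset.mem_sdiff] at hx hx' g1 g2
    exact ⟨y, by tauto, x, hx.1, y', by tauto, x', hx'.1, hx.2, hx'.2, g3.symm, g4.symm, g5.symm⟩
  · obtain ⟨a, ha, b, hb, c, hc, d, hd, h⟩ := hC (X ∩ C) Finset.inter_subset_right
      (Finset.nonempty_iff_ne_empty.2 e1) e2
    exact ⟨a, by grind, b, by grind, c, by grind, d, by grind, by grind⟩

theorem exists_minimal_subset (P : Finset V → Prop) {D : Finset V} (hD : P D) :
    ∃ D' ⊆ D, P D' ∧ ∀ D'' ⊆ D', P D'' → D'' = D' := by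
  induction D using Finset.strongInduction with
  | H D ih =>
    by_cases h : ∃ E, E ⊂ D ∧ P E
    · obtain ⟨E, hE, hPE⟩ := h
      obtain ⟨D', h1, h2⟩ := ih E hE hPE
      exact ⟨D', h1.trans hE.1, h2⟩
    · refine ⟨D, subset_rfl, hD, fun E hE hPE => ?_⟩
      by_contra hne
      exact h ⟨E, hE.ssubset_of_ne hne, hPE⟩
end Connectivity

section Completion

variable {V : Type*} [DecidableEq V] {G : SimpleGraph V}

/-- In a subcubic graph without `K₄`, a 2-edge-connected set `C` properly contained in a
2-edge-connected set can be enlarged to such a set keeping some vertex of `C` unattached. -/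
theorem exists_unattached_extension (hG : Subcubic G)
    (hK : ∀ a b c d : V, G.Adj a b → G.Adj a c → G.Adj a d → G.Adj b c → G.Adj b d → ¬ G.Adj c d)
    {C S : Finset V} (hC : CutTwoConnected G C) (hS : CutTwoConnected G S) (hCS : C ⊂ S)
    {x₀ y₀ : V} (hx₀ : x₀ ∈ C) (hy₀ : y₀ ∈ C) (hxy₀ : x₀ ≠ y₀) :
    ∃ S', S' ⊆ S ∧ C ⊂ S' ∧ CutTwoConnected G S' ∧ ∃ z ∈ C, ∀ u ∈ S', u ∉ C → ¬ G.Adj z u := by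
  set P : Finset V → Prop := fun D => CutConnected G D ∧ ∃ u₁ ∈ D, ∃ u₂ ∈ D, ∃ c₁ ∈ C, ∃ c₂ ∈ C,
    G.Adj u₁ c₁ ∧ G.Adj u₂ c₂ ∧ (u₁ ≠ u₂ ∨ c₁ ≠ c₂) with hP
  obtain ⟨w, hwS, hwC⟩ := Finset.exists_of_ssubset hCS
  obtain ⟨D₀, hD₀R, ⟨hD₀, hwD₀⟩, hD₀max⟩ := exists_maximal_subset
    (fun D => CutConnected G D ∧ D.Nonempty) (D := {w}) (B := S \ C)
    ⟨cutConnected_singleton w, by simp⟩ (by simp [hwS, hwC])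
  have hPD₀ : P D₀ := by
    obtain ⟨x, hx, y, hy, x', hx', y', hy', h1, h2, h3, h4, h5⟩ := hS D₀
      (hD₀R.trans Finset.sdiff_subset) hwD₀ (by
        rintro rfl
        have := hD₀R (hCS.1 hx₀)
        simp [hx₀] at this)
    have hin : ∀ a ∈ D₀, ∀ b ∈ S, b ∉ D₀ → G.Adj a b → b ∈ C := by
      intro a ha b hb hbD hab
      by_contra hbC
      have := hD₀max (insert b D₀) (Finset.insert_subset (by simp [hb, hbC]) hD₀R)
        (Finset.subset_insert _ _) ⟨hD₀.insert_adj ha hab, by simp⟩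
      exact hbD (by rw [← this]; simp)
    exact ⟨hD₀, x, hx, x', hx', y, hin x hx y hy h1 h3, y', hin x' hx' y' hy' h2 h4, h3, h4, h5⟩
  obtain ⟨D, hDD₀, hPD, hmin⟩ := exists_minimal_subset P hPD₀
  have hDR : ∀ u ∈ D, u ∈ S ∧ u ∉ C := fun u hu => Finset.mem_sdiff.1 (hD₀R (hDD₀ hu))
  obtain ⟨hDc, u₁, hu₁, u₂, hu₂, c₁, hc₁, c₂, hc₂, h₁, h₂, hne⟩ := hPD
  have hear := hC.union_ear hDc (Finset.disjoint_right.2 fun u hu => (hDR u hu).2)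
    hc₁ hc₂ hu₁ hu₂ h₁ h₂ hne
    (fun D' hD' hc h1 h2 => hmin D' hD' ⟨hc, u₁, h1, u₂, h2, c₁, hc₁, c₂, hc₂, h₁, h₂, hne⟩)
  refine ⟨C ∪ D, Finset.union_subset hCS.1 fun u hu => (hDR u hu).1, ?_, hear, ?_⟩
  · rw [Finset.ssubset_iff_of_subset Finset.subset_union_left]
    exact ⟨u₁, by simp [hu₁], (hDR _ hu₁).2⟩
  by_contra hcon
  have hatt : ∀ z ∈ C, ∃ u ∈ D, G.Adj z u := by
    intro z hz
    by_contra h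
    refine hcon ⟨z, hz, fun u hu huC hzu => h ⟨u, ?_, hzu⟩⟩
    exact (Finset.mem_union.1 hu).resolve_left huC
  obtain ⟨a, ha, b, hb, hab, hxa, hxb⟩ := hC.exists_two_adj hx₀ hy₀ hxy₀
  obtain ⟨ux, hux, hxux⟩ := hatt _ hx₀
  obtain ⟨ua, hua, haua⟩ := hatt _ ha
  obtain ⟨ub, hub, hbub⟩ := hatt _ hb
  by_cases hdouble : ∃ u ∈ D, ∃ z ∈ C, ∃ z' ∈ C, z ≠ z' ∧ G.Adj u z ∧ G.Adj u z'
  · obtain ⟨u, hu, z, hz, z', hz', hzz, huz, huz'⟩ := hdouble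
    have hDu : {u} = D := hmin {u} (by simpa using hu)
      ⟨cutConnected_singleton u, u, by simp, u, by simp, z, hz, z', hz', huz, huz', .inr hzz⟩
    have hall : ∀ c ∈ C, G.Adj u c := by
      intro c hc
      obtain ⟨u', hu', h⟩ := hatt c hc
      rw [← hDu, Finset.mem_singleton] at hu'
      subst hu'
      exact h.symm
    have hthree : ∀ c ∈ C, c = x₀ ∨ c = a ∨ c = b := by
      intro c hc
      have := hG (hall _ hx₀) (hall _ ha) (hall _ hb) (hall _ hc)
      have := hxa.ne
      have := hxb.ne
      grind
    obtain ⟨p, hp, q, hq, hpq, hap, haq⟩ := hC.exists_two_adj ha hb hab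
    have hadj : G.Adj a b := by
      rcases hthree p hp with rfl | rfl | rfl
      · rcases hthree q hq with rfl | rfl | rfl
        · exact absurd rfl hpq
        · exact absurd haq (G.irrefl)
        · exact haq
      · exact absurd hap (G.irrefl)
      · exact hap
    exact hK u x₀ a b (hall _ hx₀) (hall _ ha) (hall _ hb) hxa hxb hadj
  · have huniq : ∀ u ∈ D, ∀ z ∈ C, ∀ z' ∈ C, G.Adj u z → G.Adj u z' → z = z' := by
      intro u hu z hz z' hz' h1 h2
      by_contra hh
      exact hdouble ⟨u, hu, z, hz, z', hz', hh, h1, h2⟩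
    have nxa : ux ≠ ua := by
      rintro rfl
      exact hxa.ne (huniq _ hux _ hx₀ _ ha hxux.symm haua.symm)
    have nxb : ux ≠ ub := by
      rintro rfl
      exact hxb.ne (huniq _ hux _ hx₀ _ hb hxux.symm hbub.symm)
    have nab : ua ≠ ub := by
      rintro rfl
      exact hab (huniq _ hua _ ha _ hb haua.symm hbub.symm)
    obtain ⟨D', hD'D, ⟨hD'c, huxD', honly⟩, hD'max⟩ := exists_maximal_subset
      (fun E => CutConnected G E ∧ ux ∈ E ∧ ∀ u ∈ E, ∀ c ∈ C, G.Adj u c → u = ux)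
      (D := {ux}) (B := D)
      ⟨cutConnected_singleton ux, by simp, fun u hu _ _ _ => by simpa using hu⟩ (by simpa using hux)
    obtain ⟨v, hv, y, hy, hyD', hvy⟩ := hDc D' hD'D ⟨ux, huxD'⟩
      (by rintro rfl; exact nxa (honly _ hua _ ha haua.symm).symm)
    have hins := hD'c.insert_adj hv hvy
    have hyatt : ∃ c ∈ C, G.Adj y c := by
      by_contra hno
      have := hD'max (insert y D') (Finset.insert_subset hy hD'D) (Finset.subset_insert _ _)
        ⟨hins, by simp [huxD'], by
          intro u hu c hc huc
          rcases Finset.mem_insert.1 hu with rfl | hu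
          · exact absurd ⟨c, hc, huc⟩ hno
          · exact honly u hu c hc huc⟩
      exact hyD' (by rw [← this]; simp)
    obtain ⟨c, hc, hyc⟩ := hyatt
    have hDeq := hmin (insert y D') (Finset.insert_subset hy hD'D)
      ⟨hins, ux, by simp [huxD'], y, by simp, x₀, hx₀, c, hc, hxux.symm, hyc,
        .inl (by rintro rfl; exact hyD' huxD')⟩
    have e1 : ua = y := by
      rw [← hDeq, Finset.mem_insert] at hua
      exact hua.resolve_right fun h => nxa (honly _ h _ ha haua.symm).symm
    have e2 : ub = y := by
      rw [← hDeq, Finset.mem_insert] at hub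
      exact hub.resolve_right fun h => nxb (honly _ h _ hb hbub.symm).symm
    exact nab (e1.trans e2.symm)

/-- A set `S` is completable if, whatever vertices outside of `S` have been selected, one can
select an independent set in `S` and a root `r` with two selected neighbors such that the rest of
`S` stays connected. -/
def Completable (G : SimpleGraph V) (S : Finset V) : Prop :=
  ∀ J : Set V, (∀ j ∈ J, j ∉ S) → ∃ A ⊆ S, ∃ r ∈ S, r ∉ A ∧ CutConnected G (S \ A) ∧
    (∀ a ∈ A, ∀ b ∈ A, ¬ G.Adj a b) ∧ (∀ a ∈ A, ∀ j ∈ J, ¬ G.Adj a j) ∧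
    ∃ i₁ i₂, i₁ ≠ i₂ ∧ (i₁ ∈ A ∨ i₁ ∈ J) ∧ (i₂ ∈ A ∨ i₂ ∈ J) ∧ G.Adj r i₁ ∧ G.Adj r i₂

theorem completable_of_unattached (hG : Subcubic G) {C S : Finset V} (hC : CutTwoConnected G C)
    (hS : CutTwoConnected G S) (hCS : C ⊂ S) {z : V} (hz : z ∈ C)
    (hzu : ∀ u ∈ S, u ∉ C → ¬ G.Adj z u) {x₀ : V} (hx₀ : x₀ ∈ C) (hzx₀ : z ≠ x₀) :
    Completable G S := by
  intro J hJ
  obtain ⟨p, hp, u₀, hu₀, hu₀C, hpu₀⟩ := hS.cutConnected C hCS.1 ⟨z, hz⟩ hCS.ne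
  have two : ∀ c ∈ C, ∃ a ∈ C, ∃ b ∈ C, a ≠ b ∧ G.Adj c a ∧ G.Adj c b := by
    intro c hc
    by_cases h : c = z
    · exact hC.exists_two_adj hc hx₀ (by rwa [h])
    · exact hC.exists_two_adj hc hz h
  by_cases hM : ∃ v ∈ S, ∃ j ∈ J, G.Adj v j
  · classical
    obtain ⟨v, hv, j, hj, hvj⟩ := hM
    have hpJ : ∀ j ∈ J, ¬ G.Adj p j := by
      intro j hj hpj
      obtain ⟨a, ha, b, hb, hab, hpa, hpb⟩ := two p hp
      have := hG hpa hpb hpu₀ hpj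
      have := hJ j hj
      have := hCS.1 ha
      have := hCS.1 hb
      grind
    obtain ⟨r, hr, v', hv', hv'X, hrv'⟩ := hS.cutConnected
      (S.filter fun v => ∃ j ∈ J, G.Adj v j) (Finset.filter_subset _ _)
      ⟨v, by simpa [hv] using ⟨j, hj, hvj⟩⟩
      (fun h => by
        have hpS := hCS.1 hp
        rw [← h, Finset.mem_filter] at hpS
        obtain ⟨-, j, hj, hpj⟩ := hpS
        exact hpJ j hj hpj)
    obtain ⟨hrS, j', hj', hrj'⟩ := Finset.mem_filter.1 hr
    have hv'J : ∀ j ∈ J, ¬ G.Adj v' j := fun j hj h =>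
      hv'X (Finset.mem_filter.2 ⟨hv', j, hj, h⟩)
    refine ⟨{v'}, by simpa using hv', r, hrS, by simpa using hrv'.ne, ?_, by simp, by simpa using hv'J,
      v', j', ?_, by simp, .inr hj', hrv', hrj'⟩
    · rw [Finset.sdiff_singleton_eq_erase]
      exact hS.erase hG v'
    · rintro rfl
      exact hJ _ hj' hv'
  · classical
    have hno : ∀ a ∈ S, ∀ j ∈ J, ¬ G.Adj a j := fun a ha j hj h => hM ⟨a, ha, j, hj, h⟩
    obtain ⟨r, hr, v', hv', hv'X, hrv'⟩ := hC.cutConnected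
      (C.filter fun c => ∃ u ∈ S, u ∉ C ∧ G.Adj c u) (Finset.filter_subset _ _)
      ⟨p, by simpa [hp] using ⟨u₀, hu₀, hu₀C, hpu₀⟩⟩
      (fun h => by
        rw [← h, Finset.mem_filter] at hz
        obtain ⟨-, u, hu, huC, hzu'⟩ := hz
        exact hzu u hu huC hzu')
    obtain ⟨hrC, u, hu, huC, hru⟩ := Finset.mem_filter.1 hr
    have hv'u : ∀ u ∈ S, u ∉ C → ¬ G.Adj v' u := fun u hu huC h =>
      hv'X (Finset.mem_filter.2 ⟨hv', u, hu, huC, h⟩)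
    have hv'S := hCS.1 hv'
    refine ⟨{u, v'}, by simp [Finset.insert_subset_iff, hu, hv'S], r, hCS.1 hrC, ?_, ?_, ?_,
      fun a ha j hj => hno a ?_ j hj, u, v', ?_, by simp, by simp, hru, hrv'⟩
    · simpa using ⟨hru.ne, hrv'.ne⟩
    · have hout : ∀ Z ⊆ S \ {u, v'}, Z.Nonempty → (∀ y ∈ Z, y ∉ C) →
          ∃ x ∈ Z, ∃ y ∈ S \ {u, v'}, y ∉ Z ∧ G.Adj x y := by
        intro Z hZ hZne hZC
        have hvZ : v' ∉ Z := fun h => by simpa using hZ h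
        obtain ⟨x, hx, y, hy, hyZ, hxy⟩ := hS.erase hG u Z (fun y hy => by have := hZ hy; grind)
          hZne (by rintro rfl; exact hvZ (by simp [hv'S]; rintro rfl; exact huC hv'))
        have hxS : x ∈ S := by have := hZ hx; grind
        refine ⟨x, hx, y, ?_, hyZ, hxy⟩
        have : y ≠ v' := by
          rintro rfl
          exact hv'u x hxS (hZC x hx) hxy.symm
        grind
      intro X hX hXne hXQ
      by_cases h1 : X ∩ C = ∅
      · apply hout X hX hXne
        intro y hy hyC
        have : y ∈ X ∩ C := by simp [hy, hyC]
        simp [h1] at this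
      by_cases h2 : (((S \ {u, v'}) \ X) ∩ C) = ∅
      · obtain ⟨x, hx, y, hy, hyZ, hxy⟩ := hout ((S \ {u, v'}) \ X) Finset.sdiff_subset
          (by rw [Finset.sdiff_nonempty]; exact fun hh => hXQ (Finset.Subset.antisymm hX hh))
          (by
            intro y hy hyC
            have : y ∈ ((S \ {u, v'}) \ X) ∩ C := Finset.mem_inter.2 ⟨hy, hyC⟩
            simp [h2] at this)
        have := Finset.mem_sdiff.1 hx
        exact ⟨y, by_contra fun h => hyZ (Finset.mem_sdiff.2 ⟨hy, h⟩), x, this.1, this.2, hxy.symm⟩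
      · obtain ⟨y₁, hy₁⟩ := Finset.nonempty_iff_ne_empty.2 h2
        obtain ⟨x, hx, y, hy, hyX, hxy⟩ := hC.erase hG v' (X ∩ C)
          (fun y hy => by
            have h1 := hX (Finset.mem_inter.1 hy).1
            have h2 := (Finset.mem_inter.1 hy).2
            grind) (Finset.nonempty_iff_ne_empty.2 h1)
          (by
            intro hh
            have hmem : y₁ ∈ C.erase v' := by grind
            rw [← hh] at hmem
            grind)
        have hyC : y ∈ C := Finset.mem_of_mem_erase hy
        refine ⟨x, (Finset.mem_inter.1 hx).1, y, ?_, fun h => hyX (by simp [h, hyC]), hxy⟩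
        have := hCS.1 hyC
        have := Finset.ne_of_mem_erase hy
        have : y ≠ u := by rintro rfl; exact huC hyC
        grind
    · have := hv'u u hu huC
      have h' : ¬ G.Adj u v' := fun h => this h.symm
      simp [this, h']
    · rcases Finset.mem_insert.1 ha with rfl | h
      · exact hu
      · rw [Finset.mem_singleton.1 h]; exact hv'S
    · rintro rfl
      exact huC hv'

/-- A connected set can be ranked so that every vertex other than the root has a neighbor of
smaller rank. -/
theorem CutConnected.exists_rank {Q : Finset V} (h : CutConnected G Q) {r : V} (hr : r ∈ Q) :
    ∃ d : V → ℕ, ∀ w ∈ Q, d w < Q.card ∧ (w ≠ r → ∃ w' ∈ Q, G.Adj w w' ∧ d w' < d w) := by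
  have key : ∀ k, k + 1 ≤ Q.card → ∃ X ⊆ Q, X.card = k + 1 ∧ r ∈ X ∧ ∃ d : V → ℕ,
      ∀ w ∈ X, d w < k + 1 ∧ (w ≠ r → ∃ w' ∈ X, G.Adj w w' ∧ d w' < d w) := by
    intro k
    induction k with
    | zero =>
      intro _
      exact ⟨{r}, by simpa using hr, by simp, by simp, fun _ => 0, by simp⟩
    | succ k ih =>
      intro hk
      obtain ⟨X, hX, hcard, hrX, d, hd⟩ := ih (by omega)
      obtain ⟨x, hx, y, hy, hyX, hxy⟩ := h X hX ⟨r, hrX⟩ (by rintro rfl; omega)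
      refine ⟨insert y X, Finset.insert_subset hy hX, by rw [Finset.card_insert_of_notMem hyX, hcard],
        by simp [hrX], fun w => if w = y then k + 1 else d w, ?_⟩
      intro w hw
      by_cases hwy : w = y
      · subst hwy
        refine ⟨by simp, fun _ => ⟨x, by simp [hx], hxy.symm, ?_⟩⟩
        have := (hd x hx).1
        simp [hxy.ne, this]
      · have hwX : w ∈ X := (Finset.mem_insert.1 hw).resolve_left hwy
        obtain ⟨h1, h2⟩ := hd w hwX
        refine ⟨by simp only [hwy, if_false]; omega, fun hwr => ?_⟩
        obtain ⟨w', hw', hadj, hlt⟩ := h2 hwr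
        have : w' ≠ y := by rintro rfl; exact hyX hw'
        exact ⟨w', by simp [hw'], hadj, by simpa [hwy, this] using hlt⟩
  have hpos : 0 < Q.card := Finset.card_pos.2 ⟨r, hr⟩
  obtain ⟨X, hX, hcard, -, d, hd⟩ := key (Q.card - 1) (by omega)
  have : X = Q := Finset.eq_of_subset_of_card_le hX (by omega)
  subst this
  refine ⟨d, fun w hw => ?_⟩
  obtain ⟨h1, h2⟩ := hd w hw
  exact ⟨by omega, h2⟩

end Completion

section BreadthFirst

variable {V : Type*} {G : SimpleGraph V} {v : V} {par : V → V}

theorem dist_le_add_one_of_adj {x y : V} (hx : G.Reachable v x) (hxy : G.Adj x y) :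
    G.dist v y ≤ G.dist v x + 1 := by
  obtain ⟨p, hp⟩ := hx.exists_walk_length_eq_dist
  calc G.dist v y ≤ (p.concat hxy).length := dist_le _
    _ = G.dist v x + 1 := by rw [Walk.length_concat, hp]

theorem exists_parent {x : V} (hx : G.Reachable v x) (hxv : x ≠ v) :
    ∃ y, G.Adj x y ∧ G.dist v y + 1 = G.dist v x := by
  obtain ⟨p, hp⟩ := hx.symm.exists_walk_length_eq_dist
  cases p with
  | nil => exact absurd rfl hxv
  | cons h q =>
    rename_i y
    refine ⟨y, h, le_antisymm ?_ (dist_le_add_one_of_adj (hx.trans h.reachable) h.symm)⟩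
    rw [Walk.length_cons] at hp
    rw [dist_comm, dist_comm (u := v), ← hp]
    exact Nat.succ_le_succ (dist_le q)

/-- `par` maps every vertex reachable from `v` to its parent in a breadth-first tree. -/
def IsParent (G : SimpleGraph V) (v : V) (par : V → V) : Prop :=
  ∀ x, G.Reachable v x → x ≠ v → G.Adj x (par x) ∧ G.dist v (par x) + 1 = G.dist v x

/-- Edges that do not belong to the breadth-first tree. -/
def Nontree (G : SimpleGraph V) (par : V → V) (x y : V) : Prop :=
  G.Adj x y ∧ par x ≠ y ∧ par y ≠ x

theorem exists_isParent (G : SimpleGraph V) (v : V) : ∃ par, IsParent G v par := by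
  classical
  have : ∀ x, ∃ y, G.Reachable v x → x ≠ v → G.Adj x y ∧ G.dist v y + 1 = G.dist v x := by
    intro x
    by_cases h : G.Reachable v x ∧ x ≠ v
    · obtain ⟨y, hy⟩ := exists_parent h.1 h.2
      exact ⟨y, fun _ _ => hy⟩
    · exact ⟨x, fun h1 h2 => absurd ⟨h1, h2⟩ h⟩
  choose par hpar using this
  exact ⟨par, hpar⟩

theorem IsParent.eq_root (h : IsParent G v par) {x : V} (hxv : G.Adj x v) : par x = v := by
  have hx : G.Reachable v x := hxv.symm.reachable
  obtain ⟨h1, h2⟩ := h x hx hxv.ne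
  have h3 : G.dist v x = 1 := dist_eq_one_iff_adj.2 hxv.symm
  have h4 : G.dist v (par x) = 0 := by omega
  exact ((hx.trans h1.reachable).dist_eq_zero_iff.1 h4).symm

/-- The set of ancestors of a vertex. -/
theorem IsParent.exists_ancestors [DecidableEq V] (h : IsParent G v par) (k : ℕ) :
    ∀ x, G.Reachable v x → G.dist v x = k → ∃ A : Finset V, CutConnected G A ∧ v ∈ A ∧ x ∈ A ∧
      A.card ≤ k + 1 ∧
      ∀ z ∈ A, z = x ∨ (G.dist v z < k ∧ (G.dist v z + 1 = k → z = par x)) := by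
  induction k with
  | zero =>
    intro x hx hk
    have := hx.dist_eq_zero_iff.1 hk
    subst this
    exact ⟨{v}, cutConnected_singleton v, by simp, by simp, by simp, by simp⟩
  | succ k ih =>
    intro x hx hk
    have hxv : x ≠ v := by rintro rfl; simp at hk
    obtain ⟨h1, h2⟩ := h x hx hxv
    obtain ⟨A, hA, hvA, hpA, hcard, hz⟩ := ih (par x) (hx.trans h1.reachable) (by omega)
    refine ⟨insert x A, hA.insert_adj hpA h1.symm, by simp [hvA], by simp,
      (Finset.card_insert_le _ _).trans (by omega), fun z hzA => ?_⟩
    rcases Finset.mem_insert.1 hzA with rfl | hzA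
    · exact .inl rfl
    · right
      rcases hz z hzA with rfl | ⟨h3, h4⟩
      · exact ⟨by omega, fun _ => rfl⟩
      · exact ⟨by omega, fun _ => by omega⟩

theorem Nontree.symm {x y : V} (h : Nontree G par x y) : Nontree G par y x :=
  ⟨h.1.symm, h.2.2, h.2.1⟩

theorem Nontree.ne_root (h : IsParent G v par) {x y : V} (hxy : Nontree G par x y) : x ≠ v := by
  rintro rfl
  exact hxy.2.2 (h.eq_root hxy.1.symm)

/-- Every edge outside of the breadth-first tree closes a small 2-edge-connected set. -/
theorem Nontree.exists_fundamental [DecidableEq V] (h : IsParent G v par) {x y : V}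
    (hx : G.Reachable v x) (hxy : Nontree G par x y) :
    ∃ C : Finset V, CutTwoConnected G C ∧ x ∈ C ∧ y ∈ C ∧ par x ∈ C ∧
      C.card ≤ 2 * G.dist v x + 3 ∧
      ∀ z ∈ C, z = x ∨ z = y ∨ G.dist v z < G.dist v y ∨ z = par x ∨
        G.dist v z + 1 < G.dist v x := by
  have hy := hx.trans hxy.1.reachable
  obtain ⟨p1, p2⟩ := h x hx (hxy.ne_root h)
  have l1 := dist_le_add_one_of_adj hx hxy.1
  have l2 := dist_le_add_one_of_adj hy hxy.1.symm
  obtain ⟨A, hA, hvA, hyA, hAc, hAz⟩ := h.exists_ancestors _ y hy rfl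
  obtain ⟨B, hB, hvB, hpB, hBc, hBz⟩ := h.exists_ancestors _ (par x) (hx.trans p1.reachable) rfl
  have hxAB : x ∉ A ∪ B := by
    intro hxAB
    rcases Finset.mem_union.1 hxAB with hm | hm
    · rcases hAz x hm with e | ⟨e1, e2⟩
      · exact hxy.1.ne e
      · exact hxy.2.2 (e2 (by omega)).symm
    · rcases hBz x hm with e | ⟨e1, e2⟩
      · exact p1.ne e
      · omega
  obtain ⟨D, hD, ⟨hDc, hyD, hpD⟩, hmin⟩ := exists_minimal_subset
    (fun D => CutConnected G D ∧ y ∈ D ∧ par x ∈ D) (D := A ∪ B)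
    ⟨hA.union hB hvA hvB, by simp [hyA], by simp [hpB]⟩
  have hear := (cutTwoConnected_singleton x).union_ear hDc
    (Finset.disjoint_singleton_left.2 fun hm => hxAB (hD hm)) (by simp) (by simp) hyD hpD
    hxy.1.symm p1.symm (.inl (Ne.symm hxy.2.1)) (fun D' h1 h2 h3 h4 => hmin D' h1 ⟨h2, h3, h4⟩)
  refine ⟨_, hear, by simp, by simp [hyD], by simp [hpD], ?_, ?_⟩
  · have c1 := Finset.card_union_le {x} D
    have c2 := Finset.card_le_card hD
    have c3 := Finset.card_union_le A B
    rw [Finset.card_singleton] at c1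
    omega
  · intro z hz
    rcases Finset.mem_union.1 hz with hz | hz
    · exact .inl (by simpa using hz)
    rcases Finset.mem_union.1 (hD hz) with hz | hz
    · rcases hAz z hz with e | e
      · exact .inr (.inl e)
      · exact .inr (.inr (.inl e.1))
    · rcases hBz z hz with e | e
      · exact .inr (.inr (.inr (.inl e)))
      · exact .inr (.inr (.inr (.inr (by omega))))

/-- Near a vertex around which all degrees are three there is a small
2-edge-connected set properly containing another one. -/
theorem exists_nested_cutTwoConnected [Fintype V] [DecidableEq V] (v : V) (m : ℕ)
    (hm : Fintype.card V < 2 ^ m)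
    (hdeg : ∀ x, G.Reachable v x → G.dist v x ≤ 2 * m →
      ∃ a b c, a ≠ b ∧ a ≠ c ∧ b ≠ c ∧ G.Adj x a ∧ G.Adj x b ∧ G.Adj x c) :
    ∃ C S : Finset V, CutTwoConnected G C ∧ CutTwoConnected G S ∧ C ⊂ S ∧
      S.card ≤ 8 * m + 6 ∧ (∃ x ∈ C, ∃ y ∈ C, x ≠ y) ∧
      ∃ x ∈ C, G.Reachable v x ∧ G.dist v x ≤ 2 * m := by
  classical
  by_contra hcon
  obtain ⟨par, hpar⟩ := exists_isParent G v
  have hsub : ∀ C₁ C₂ : Finset V, CutTwoConnected G C₁ → CutTwoConnected G C₂ →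
      C₁.card ≤ 4 * m + 3 → C₂.card ≤ 4 * m + 3 → ∀ w ∈ C₁, w ∈ C₂ → G.Reachable v w →
      G.dist v w ≤ 2 * m → ∀ y ∈ C₁, w ≠ y → ∀ z ∈ C₂, z ∈ C₁ := by
    intro C₁ C₂ h1 h2 k1 k2 w w1 w2 hw hwm y hy hwy z hz
    by_contra hzC
    refine hcon ⟨C₁, C₁ ∪ C₂, h1, h1.union h2 w1 w2, ?_, ?_, ⟨w, w1, y, hy, hwy⟩, w, w1,
      hw, hwm⟩
    · rw [Finset.ssubset_iff_of_subset Finset.subset_union_left]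
      exact ⟨z, by simp [hz], hzC⟩
    · have := Finset.card_union_le C₁ C₂
      omega
  have huniq : ∀ w, G.Reachable v w → G.dist v w ≤ 2 * m → ∀ x y, Nontree G par w x →
      Nontree G par w y → x = y := by
    have aux : ∀ w, G.Reachable v w → G.dist v w ≤ 2 * m → ∀ x y, Nontree G par w x →
      Nontree G par w y → x ≠ y → G.dist v y < G.dist v x := by
      intro w hw hwm x y hx hy hxy
      obtain ⟨C₁, h1, w1, x1, -, c1, z1⟩ := hx.exists_fundamental hpar hw
      obtain ⟨C₂, h2, w2, y2, -, c2, -⟩ := hy.exists_fundamental hpar hw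
      have := dist_le_add_one_of_adj (hw.trans hy.1.reachable) hy.1.symm
      rcases z1 y (hsub C₁ C₂ h1 h2 (by omega) (by omega) w w1 w2 hw hwm x x1 hx.1.ne y y2)
        with e | e | e | e | e
      · exact absurd e.symm hy.1.ne
      · exact absurd e.symm hxy
      · exact e
      · exact absurd e.symm hy.2.1
      · omega
    intro w hw hwm x y hx hy
    by_contra hxy
    have a1 := aux w hw hwm x y hx hy hxy
    have a2 := aux w hw hwm y x hy hx (Ne.symm hxy)
    omega
  have hchild : ∀ x, G.Reachable v x → ∀ y, y ≠ v → G.Adj x y → par y = x →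
      G.dist v y = G.dist v x + 1 := by
    intro x hx y hyv hxy hy
    have := (hpar y (hx.trans hxy.reachable) hyv).2
    rw [hy] at this
    exact this.symm
  have hcons : ∀ x, G.Reachable v x → ∀ x' y y', Nontree G par x x' → y ≠ v → G.Adj x y →
      par y = x → G.dist v y ≤ 2 * m → ¬ Nontree G par y y' := by
    intro x hx x' y y' hxx' hyv hxy hpy hym hyy'
    have hy := hx.trans hxy.reachable
    have hd := hchild x hx y hyv hxy hpy
    obtain ⟨C₁, h1, w1, x1, -, c1, z1⟩ := hxx'.exists_fundamental hpar hx
    obtain ⟨C₂, h2, y2, -, w2, c2, -⟩ := hyy'.exists_fundamental hpar hy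
    rw [hpy] at w2
    have := dist_le_add_one_of_adj hx hxx'.1
    rcases z1 y (hsub C₁ C₂ h1 h2 (by omega) (by omega) x w1 w2 hx (by omega) x' x1 hxx'.1.ne y y2)
        with e | e | e | e | e
    · exact hxy.ne e.symm
    · exact hxx'.2.2 (e ▸ hpy)
    · omega
    · have := (hpar x hx (hxx'.ne_root hpar)).2
      rw [← e] at this
      omega
    · omega
  have hkids : ∀ x, G.Reachable v x → x ≠ v → G.dist v x ≤ 2 * m →
      (∃ y z, y ≠ z ∧ (y ≠ v ∧ G.Adj x y ∧ par y = x) ∧ (z ≠ v ∧ G.Adj x z ∧ par z = x)) ∨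
      (∃ y z, (y ≠ v ∧ G.Adj x y ∧ par y = x) ∧ Nontree G par x z) := by
    intro x hx hxv hxm
    have hcases : ∀ y, G.Adj x y → y = par x ∨ (y ≠ v ∧ G.Adj x y ∧ par y = x) ∨
        Nontree G par x y := by
      intro y hxy
      by_cases h1 : y = par x
      · exact .inl h1
      by_cases h2 : par y = x
      · exact .inr (.inl ⟨by rintro rfl; exact h1 (hpar.eq_root hxy).symm, hxy, h2⟩)
      · exact .inr (.inr ⟨hxy, Ne.symm h1, h2⟩)
    obtain ⟨a, b, c, hab, hac, hbc, ha, hb, hc⟩ := hdeg x hx hxm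
    have u1 := huniq x hx hxm
    rcases hcases a ha with e1 | e1 | e1 <;> rcases hcases b hb with e2 | e2 | e2 <;>
      rcases hcases c hc with e3 | e3 | e3 <;> grind
  have hgrand : ∀ x, G.Reachable v x → x ≠ v → G.dist v x + 1 ≤ 2 * m → ∃ y z, y ≠ z ∧
      (G.Reachable v y ∧ G.dist v y = G.dist v x + 2 ∧ par (par y) = x) ∧
      (G.Reachable v z ∧ G.dist v z = G.dist v x + 2 ∧ par (par z) = x) := by
    intro x hx hxv hxm
    have hstep : ∀ y, (y ≠ v ∧ G.Adj x y ∧ par y = x) → ∀ z, (z ≠ v ∧ G.Adj y z ∧ par z = y) →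
        G.Reachable v z ∧ G.dist v z = G.dist v x + 2 ∧ par (par z) = x := by
      intro y hy z hz
      have hyr := hx.trans hy.2.1.reachable
      have e1 := hchild x hx y hy.1 hy.2.1 hy.2.2
      have e2 := hchild y hyr z hz.1 hz.2.1 hz.2.2
      exact ⟨hyr.trans hz.2.1.reachable, by omega, by rw [hz.2.2, hy.2.2]⟩
    have hone : ∀ y, (y ≠ v ∧ G.Adj x y ∧ par y = x) → G.Reachable v y ∧ G.dist v y ≤ 2 * m := by
      intro y hy
      have e1 := hchild x hx y hy.1 hy.2.1 hy.2.2
      exact ⟨hx.trans hy.2.1.reachable, by omega⟩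
    rcases hkids x hx hxv (by omega) with ⟨y, z, hyz, hy, hz⟩ | ⟨y, x', hy, hx'⟩
    · have hex : ∀ y, (y ≠ v ∧ G.Adj x y ∧ par y = x) → ∃ z, z ≠ v ∧ G.Adj y z ∧ par z = y := by
        intro y hy
        rcases hkids y (hone y hy).1 hy.1 (hone y hy).2 with ⟨a, -, -, ha, -⟩ | ⟨a, -, ha, -⟩ <;>
          exact ⟨a, ha⟩
      obtain ⟨a, ha⟩ := hex y hy
      obtain ⟨b, hb⟩ := hex z hz
      refine ⟨a, b, ?_, hstep y hy a ha, hstep z hz b hb⟩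
      rintro rfl
      exact hyz (ha.2.2.symm.trans hb.2.2)
    · rcases hkids y (hone y hy).1 hy.1 (hone y hy).2 with ⟨a, b, hab, ha, hb⟩ | ⟨a, y', ha, hy'⟩
      · exact ⟨a, b, hab, hstep y hy a ha, hstep y hy b hb⟩
      · exact absurd hy' (hcons x hx x' y y' hx' hy.1 hy.2.1 hy.2.2 (hone y hy).2)
  have hgrow : ∀ j, j ≤ m →
      2 ^ j ≤ (Finset.univ.filter fun x => G.Reachable v x ∧ G.dist v x = 1 + 2 * j).card := by
    intro j
    induction j with
    | zero =>
      intro _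
      obtain ⟨a, -, -, -, -, -, ha, -⟩ := hdeg v (Reachable.refl v) (by simp)
      exact Finset.card_pos.2 ⟨a, by simp [ha.reachable, ha]⟩
    | succ j ih =>
      intro hj
      have := ih (by omega)
      set L := Finset.univ.filter fun x => G.Reachable v x ∧ G.dist v x = 1 + 2 * j
      set L' := Finset.univ.filter fun x => G.Reachable v x ∧ G.dist v x = 1 + 2 * (j + 1)
      have hfib : ∀ x ∈ L, 2 ≤ (L'.filter fun y => par (par y) = x).card := by
        intro x hx
        obtain ⟨hxr, hxd⟩ := (Finset.mem_filter.1 hx).2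
        obtain ⟨y, z, hyz, hy, hz⟩ := hgrand x hxr (by rintro rfl; simp at hxd; omega) (by omega)
        rw [← Finset.card_pair hyz]
        apply Finset.card_le_card
        intro w hw
        simp only [Finset.mem_insert, Finset.mem_singleton] at hw
        rcases hw with rfl | rfl
        · simp only [L', Finset.mem_filter, Finset.mem_univ, true_and]
          exact ⟨⟨hy.1, by omega⟩, hy.2.2⟩
        · simp only [L', Finset.mem_filter, Finset.mem_univ, true_and]
          exact ⟨⟨hz.1, by omega⟩, hz.2.2⟩
      calc 2 ^ (j + 1) = 2 ^ j * 2 := pow_succ _ _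
        _ ≤ L.card * 2 := Nat.mul_le_mul_right _ this
        _ ≤ ∑ x ∈ L, (L'.filter fun y => par (par y) = x).card := by
          rw [← smul_eq_mul]
          exact Finset.card_nsmul_le_sum _ _ _ hfib
        _ = (L.biUnion fun x => L'.filter fun y => par (par y) = x).card := by
          rw [Finset.card_biUnion]
          intro x _ y _ hxy
          rw [Function.onFun, Finset.disjoint_left]
          intro z hz hz'
          exact hxy ((Finset.mem_filter.1 hz).2.symm.trans (Finset.mem_filter.1 hz').2)
        _ ≤ L'.card := Finset.card_le_card (by
          intro z hz
          obtain ⟨x, -, hx⟩ := Finset.mem_biUnion.1 hz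
          exact (Finset.mem_filter.1 hx).1)
  have h1 := hgrow m le_rfl
  have h2 := Finset.card_le_univ (Finset.univ.filter fun x => G.Reachable v x ∧ G.dist v x = 1 + 2 * m)
  omega

end BreadthFirst

/-- A partial assignment on `U`: an independent set `I` and levels on the remaining vertices of `U`
such that each of them has at most one remaining neighbor of smaller level. -/
structure Layered {V : Type*} (G : SimpleGraph V) (U I : Set V) (l : V → ℕ) (N : ℕ) : Prop where
  subset : I ⊆ U
  indep : ∀ a ∈ I, ∀ b ∈ I, ¬ G.Adj a b
  lt : ∀ v ∈ U, v ∉ I → l v < N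
  ne : ∀ u ∈ U, u ∉ I → ∀ v ∈ U, v ∉ I → G.Adj u v → l u ≠ l v
  unique : ∀ v ∈ U, v ∉ I → ∀ a ∈ U, a ∉ I → ∀ b ∈ U, b ∉ I → G.Adj v a → G.Adj v b →
    l a < l v → l b < l v → a = b

section Layering

variable {V : Type*} {G : SimpleGraph V} {U I W : Set V} {l : V → ℕ} {N : ℕ}

theorem Layered.exists_extend (h : Layered G U I l N) (hWU : ∀ w ∈ W, w ∉ U)
    (hW : ∀ a ∈ W, ∀ b ∈ W, ¬ G.Adj a b)
    (hfree : ∀ w ∈ W, (∀ i ∈ I, ¬ G.Adj w i) ∨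
      ∀ a ∈ U, a ∉ I → ∀ b ∈ U, b ∉ I → G.Adj w a → G.Adj w b → a = b) :
    ∃ I' l', Layered G (U ∪ W) I' l' (N + 1) ∧ (∀ v ∈ U, v ∈ I' ↔ v ∈ I) ∧
      ∀ w ∈ W, w ∈ I' ↔ ∀ i ∈ I, ¬ G.Adj w i := by
  classical
  have hIU := h.subset
  refine ⟨I ∪ {w ∈ W | ∀ i ∈ I, ¬ G.Adj w i}, fun v => if v ∈ W then N else l v,
    ⟨?_, ?_, ?_, ?_, ?_⟩, ?_, ?_⟩
  · rintro v (hv | hv)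
    · exact .inl (hIU hv)
    · exact .inr hv.1
  · rintro a (ha | ha) b (hb | hb) hab
    · exact h.indep a ha b hb hab
    · exact hb.2 a ha hab.symm
    · exact ha.2 b hb hab
    · exact hW a ha.1 b hb.1 hab
  · rintro v (hv | hv) hvI
    · have hvW : v ∉ W := fun hw => hWU v hw hv
      have := h.lt v hv fun hI => hvI (.inl hI)
      simp only [hvW, if_false]
      omega
    · simp [hv]
  · rintro u (hu | hu) huI v (hv | hv) hvI huv
    · have huW : u ∉ W := fun hw => hWU u hw hu
      have hvW : v ∉ W := fun hw => hWU v hw hv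
      simp only [huW, hvW, if_false]
      exact h.ne u hu (fun hI => huI (.inl hI)) v hv (fun hI => hvI (.inl hI)) huv
    · have huW : u ∉ W := fun hw => hWU u hw hu
      have := h.lt u hu fun hI => huI (.inl hI)
      simp only [huW, hv, if_false, if_true]
      omega
    · have hvW : v ∉ W := fun hw => hWU v hw hv
      have := h.lt v hv fun hI => hvI (.inl hI)
      simp only [hu, hvW, if_false, if_true]
      omega
    · exact absurd huv (hW u hu v hv)
  · intro v hv hvI a ha haI b hb hbI hva hvb hla hlb
    have haI' : a ∉ I := fun hI => haI (.inl hI)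
    have hbI' : b ∉ I := fun hI => hbI (.inl hI)
    rcases hv with hv | hv
    · have hvW : v ∉ W := fun hw => hWU v hw hv
      have hvI' : v ∉ I := fun hI => hvI (.inl hI)
      have hlt := h.lt v hv hvI'
      simp only [hvW, if_false] at hla hlb
      have haW : a ∉ W := by
        intro hw
        simp only [hw, if_true] at hla
        omega
      have hbW : b ∉ W := by
        intro hw
        simp only [hw, if_true] at hlb
        omega
      simp only [haW, hbW, if_false] at hla hlb
      exact h.unique v hv hvI' a (ha.resolve_right haW) haI' b (hb.resolve_right hbW) hbI'
        hva hvb hla hlb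
    · have haU : a ∈ U := ha.resolve_right fun hw => hW v hv a hw hva
      have hbU : b ∈ U := hb.resolve_right fun hw => hW v hv b hw hvb
      rcases hfree v hv with hf | hf
      · exact absurd (.inr ⟨hv, hf⟩) hvI
      · exact hf a haU haI' b hbU hbI' hva hvb
  · intro v hv
    have hvW : v ∉ W := fun hw => hWU v hw hv
    simp [hvW]
  · intro w hw
    have hwI : w ∉ I := fun hI => hWU w hw (hIU hI)
    simp [hw, hwI]

theorem Layered.exists_extend_of_rank (h : Layered G U I l N) (hG : Subcubic G) {s : V → ℕ}
    (hs : IsProperColoring G 3 s) {d : V → ℕ} {D : ℕ} (hWU : ∀ w ∈ W, w ∉ U)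
    (hd : ∀ w ∈ W, d w < D)
    (hflow : ∀ w ∈ W, (∀ a b c, G.Adj w a → G.Adj w b → G.Adj w c → a = b ∨ a = c ∨ b = c) ∨
      ∃ w', G.Adj w w' ∧ w' ∉ U ∧ (w' ∈ W → d w' < d w)) :
    ∃ I' l', Layered G (U ∪ W) I' l' (N + 3 * D) ∧ ∀ v ∈ U, v ∈ I' ↔ v ∈ I := by
  set k : V → ℕ := fun w => 3 * (D - 1 - d w) + (s w - 1) with hk
  have hs3 : ∀ v, 1 ≤ s v ∧ s v ≤ 3 := fun v => Finset.mem_Icc.1 (hs.1 v)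
  have main : ∀ j, ∃ I' l', Layered G (U ∪ {w ∈ W | k w < j}) I' l' (N + j) ∧
      ∀ v ∈ U, v ∈ I' ↔ v ∈ I := by
    intro j
    induction j with
    | zero => exact ⟨I, l, by simpa using h, fun _ _ => Iff.rfl⟩
    | succ j ih =>
      obtain ⟨I₁, l₁, h₁, hI₁⟩ := ih
      obtain ⟨I₂, l₂, h₂, hI₂, -⟩ := h₁.exists_extend (W := {w ∈ W | k w = j}) (by
        rintro w ⟨hw, hkw⟩ (hw' | hw')
        · exact hWU w hw hw'
        · exact absurd hw'.2 (by omega)) (by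
        rintro a ⟨ha, hka⟩ b ⟨hb, hkb⟩ hab
        have := hs.2 hab
        have := hs3 a
        have := hs3 b
        simp only [hk] at hka hkb
        omega) (by
        rintro w ⟨hw, hkw⟩
        by_contra hcon
        push Not at hcon
        obtain ⟨⟨i, hi, hwi⟩, a, ha, haI, b, hb, hbI, hwa, hwb, hab⟩ := hcon
        have hai : i ≠ a := fun e => haI (e ▸ hi)
        have hbi : i ≠ b := fun e => hbI (e ▸ hi)
        rcases hflow w hw with hf | ⟨w', hww', hw'U, hw'⟩
        · have := hf i a b hwi hwa hwb
          tauto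
        · have hw'' : w' ∉ U ∪ {w ∈ W | k w < j} := by
            rintro (hu | ⟨hu, hlt⟩)
            · exact hw'U hu
            · have := hw' hu
              have := hd w hw
              have := hs3 w
              have := hs3 w'
              simp only [hk] at hkw hlt
              omega
          have e1 : i ≠ w' := fun e => hw'' (e ▸ h₁.subset hi)
          have e2 : a ≠ w' := fun e => hw'' (e ▸ ha)
          have e3 : b ≠ w' := fun e => hw'' (e ▸ hb)
          have := hG hwi hwa hwb hww'
          tauto)
      refine ⟨I₂, l₂, ?_, fun v hv => (hI₂ v (.inl hv)).trans (hI₁ v hv)⟩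
      convert h₂ using 1
      · ext v
        simp only [Set.mem_union, Set.mem_ofPred_eq, Nat.lt_succ_iff_lt_or_eq]
        tauto
      · rfl
  obtain ⟨I', l', h', hI'⟩ := main (3 * D)
  refine ⟨I', l', ?_, hI'⟩
  convert h' using 1
  ext v
  simp only [Set.mem_union, Set.mem_ofPred_eq]
  refine or_congr_right ⟨fun hv => ⟨hv, ?_⟩, fun hv => hv.1⟩
  have := hd v hv
  have := hs3 v
  simp only [hk]
  omega

end Layering

section Assembly

variable {V : Type*} {G : SimpleGraph V}

theorem exists_rank_of_near {T : Set V} {D : ℕ}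
    (hT : ∀ v, ∃ x ∈ T, ∃ p : G.Walk v x, p.length < D) :
    ∃ d : V → ℕ, (∀ v, d v < D) ∧ ∀ v ∉ T, ∃ w, G.Adj v w ∧ d w < d v := by
  classical
  have hex : ∀ v, ∃ n, ∃ x ∈ T, ∃ p : G.Walk v x, p.length = n := by
    intro v
    obtain ⟨x, hx, p, -⟩ := hT v
    exact ⟨_, x, hx, p, rfl⟩
  refine ⟨fun v => Nat.find (hex v), fun v => ?_, fun v hv => ?_⟩
  · obtain ⟨x, hx, p, hp⟩ := hT v
    exact (Nat.find_min' (hex v) ⟨x, hx, p, rfl⟩).trans_lt hp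
  · obtain ⟨x, hx, p, hp⟩ := Nat.find_spec (hex v)
    cases p with
    | nil => exact absurd hx hv
    | @cons _ w _ hvw q =>
      refine ⟨w, hvw, (Nat.find_min' (hex w) ⟨x, hx, q, rfl⟩).trans_lt ?_⟩
      exact (Nat.lt_succ_self _).trans_eq hp

theorem CutConnected.exists_walk {Q : Finset V} (h : CutConnected G Q) {x y : V} (hx : x ∈ Q)
    (hy : y ∈ Q) : ∃ p : G.Walk x y, p.length < Q.card := by
  classical
  obtain ⟨d, hd⟩ := h.exists_rank hx
  have main : ∀ n, ∀ w ∈ Q, d w = n → ∃ p : G.Walk x w, p.length ≤ n := by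
    intro n
    induction n using Nat.strong_induction_on with
    | _ n ih =>
      intro w hw hn
      by_cases hwx : w = x
      · subst hwx
        exact ⟨.nil, by simp⟩
      · obtain ⟨w', hw', hadj, hlt⟩ := (hd w hw).2 hwx
        obtain ⟨p, hp⟩ := ih (d w') (by omega) w' hw' rfl
        refine ⟨p.concat hadj.symm, ?_⟩
        rw [Walk.length_concat]
        omega
  obtain ⟨p, hp⟩ := main _ y hy rfl
  exact ⟨p, hp.trans_lt (hd y hy).1⟩

theorem exists_completable_near [Fintype V] [DecidableEq V] (hG : Subcubic G) {s : V → ℕ}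
    (hs : IsProperColoring G 3 s) (v : V) {m : ℕ} (hm : Fintype.card V < 2 ^ m)
    (hdeg : ∀ x, G.Reachable v x → G.dist v x ≤ 2 * m →
      ∃ a b c, a ≠ b ∧ a ≠ c ∧ b ≠ c ∧ G.Adj x a ∧ G.Adj x b ∧ G.Adj x c) :
    ∃ S : Finset V, Completable G S ∧ S.card ≤ 8 * m + 6 ∧
      ∀ y ∈ S, ∃ p : G.Walk v y, p.length < 10 * m + 6 := by
  obtain ⟨C, S, hC, hS, hCS, hcard, ⟨x₀, hx₀, y₀, hy₀, hxy₀⟩, x, hx, hvx, hdist⟩ :=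
    exists_nested_cutTwoConnected v m hm hdeg
  have hK : ∀ a b c d : V, G.Adj a b → G.Adj a c → G.Adj a d → G.Adj b c → G.Adj b d →
      ¬ G.Adj c d := by
    intro a b c d h1 h2 h3 h4 h5 h6
    have := hs.2 h1
    have := hs.2 h2
    have := hs.2 h3
    have := hs.2 h4
    have := hs.2 h5
    have := hs.2 h6
    have := Finset.mem_Icc.1 (hs.1 a)
    have := Finset.mem_Icc.1 (hs.1 b)
    have := Finset.mem_Icc.1 (hs.1 c)
    have := Finset.mem_Icc.1 (hs.1 d)
    omega
  obtain ⟨S', hS'S, hCS', hS', z, hz, hzu⟩ :=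
    exists_unattached_extension hG hK hC hS hCS hx₀ hy₀ hxy₀
  have hcard' := (Finset.card_le_card hS'S).trans hcard
  refine ⟨S', ?_, hcard', fun y hy => ?_⟩
  · by_cases h : z = x₀
    · exact completable_of_unattached hG hC hS' hCS' hz hzu hy₀ (by rwa [h])
    · exact completable_of_unattached hG hC hS' hCS' hz hzu hx₀ h
  · obtain ⟨p, hp⟩ := hvx.exists_walk_length_eq_dist
    obtain ⟨q, hq⟩ := hS'.cutConnected.exists_walk (hCS'.1 hx) hy
    refine ⟨p.append q, ?_⟩
    rw [Walk.length_append]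
    omega

theorem exists_completable_family [Fintype V] [DecidableEq V] (hG : Subcubic G) {s : V → ℕ}
    (hs : IsProperColoring G 3 s) {m : ℕ} (hm : Fintype.card V < 2 ^ m) :
    ∃ F : Finset (Finset V), (∀ S ∈ F, Completable G S ∧ S.card ≤ 8 * m + 6) ∧
      (∀ S ∈ F, ∀ S' ∈ F, S ≠ S' → ∀ a ∈ S, ∀ b ∈ S', a ≠ b ∧ ¬ G.Adj a b) ∧
      ∃ d : V → ℕ, (∀ v, d v < 10 * m + 8) ∧ ∀ v, (∀ S ∈ F, v ∉ S) →
        (∀ a b c, G.Adj v a → G.Adj v b → G.Adj v c → a = b ∨ a = c ∨ b = c) ∨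
        ∃ w, G.Adj v w ∧ d w < d v := by
  obtain ⟨F, -, ⟨hF₁, hF₂⟩, hFmax⟩ := exists_maximal_subset
    (fun F : Finset (Finset V) => (∀ S ∈ F, Completable G S ∧ S.card ≤ 8 * m + 6) ∧
      (∀ S ∈ F, ∀ S' ∈ F, S ≠ S' → ∀ a ∈ S, ∀ b ∈ S', a ≠ b ∧ ¬ G.Adj a b))
    (D := ∅) (B := Finset.univ) (by simp) (Finset.subset_univ _)
  refine ⟨F, hF₁, hF₂, ?_⟩
  set T : Set V := {v | (∃ S ∈ F, v ∈ S) ∨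
    ∀ a b c, G.Adj v a → G.Adj v b → G.Adj v c → a = b ∨ a = c ∨ b = c} with hT
  obtain ⟨d, hd, hdT⟩ := exists_rank_of_near (G := G) (T := T) (D := 10 * m + 8) (by
    intro v
    by_contra hcon
    have hfar : ∀ x (p : G.Walk v x), p.length < 10 * m + 8 → x ∉ T := fun x p hp hx =>
      hcon ⟨x, hx, p, hp⟩
    obtain ⟨S, hS, hcard, hnear⟩ := exists_completable_near hG hs v hm (by
      intro x hvx hdist
      obtain ⟨p, hp⟩ := hvx.exists_walk_length_eq_dist
      have := hfar x p (by omega)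
      simp only [hT, Set.mem_ofPred_eq, not_or] at this
      have := this.2
      push Not at this
      grind)
    have hsep : ∀ S' ∈ F, ∀ a ∈ S, ∀ b ∈ S', a ≠ b ∧ ¬ G.Adj a b := by
      intro S' hS' a ha b hb
      obtain ⟨p, hp⟩ := hnear a ha
      constructor
      · rintro rfl
        exact hfar a p (by omega) (.inl ⟨S', hS', hb⟩)
      · intro hab
        refine hfar b (p.concat hab) ?_ (.inl ⟨S', hS', hb⟩)
        rw [Walk.length_concat]
        omega
    have hins := hFmax (insert S F) (Finset.subset_univ _) (Finset.subset_insert _ _) (by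
      constructor
      · intro S' hS'
        rcases Finset.mem_insert.1 hS' with rfl | h
        · exact ⟨hS, hcard⟩
        · exact hF₁ S' h
      · intro S₁ h₁ S₂ h₂ hne a ha b hb
        rcases Finset.mem_insert.1 h₁ with rfl | k₁
        · rcases Finset.mem_insert.1 h₂ with rfl | h₂
          · exact absurd rfl hne
          · exact hsep S₂ h₂ a ha b hb
        · rcases Finset.mem_insert.1 h₂ with rfl | h₂
          · exact ⟨(hsep S₁ k₁ b hb a ha).1.symm, fun h => (hsep S₁ k₁ b hb a ha).2 h.symm⟩
          · exact hF₂ S₁ k₁ S₂ h₂ hne a ha b hb)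
    have hSF : S ∈ F := by
      rw [← hins]
      exact Finset.mem_insert_self _ _
    obtain ⟨-, -, r, hr, -⟩ := hS ∅ (by simp)
    exact (hsep S hSF r hr r hr).1 rfl)
  refine ⟨d, hd, fun v hv => ?_⟩
  by_cases h : v ∈ T
  · refine .inl (h.resolve_left ?_)
    rintro ⟨S, hS, hvS⟩
    exact hv S hS hvS
  · exact .inr (hdT v h)

/-- The vertices of a subcubic 3-colorable graph decompose into an independent set and
logarithmically many levels, each remaining vertex having at most one remaining neighbor below. -/
theorem exists_layered_univ [Fintype V] (hG : Subcubic G) {s : V → ℕ}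
    (hs : IsProperColoring G 3 s) {m : ℕ} (hm : Fintype.card V < 2 ^ m) :
    ∃ I l, Layered G Set.univ I l (54 * m + 44) := by
  classical
  cases isEmpty_or_nonempty V
  · exact ⟨∅, fun _ => 0, by simp, by simp, isEmptyElim, isEmptyElim, isEmptyElim⟩
  obtain ⟨F, hF₁, hF₂, d, hd, hdF⟩ := exists_completable_family hG hs hm
  have huniq : ∀ S ∈ F, ∀ S' ∈ F, ∀ v ∈ S, v ∈ S' → S = S' := by
    intro S hS S' hS' v hv hv'
    by_contra hne
    exact (hF₂ S hS S' hS' hne v hv v hv').1 rfl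
  have hadj : ∀ S ∈ F, ∀ S' ∈ F, ∀ v ∈ S, ∀ w ∈ S', G.Adj v w → S = S' := by
    intro S hS S' hS' v hv w hw hvw
    by_contra hne
    exact (hF₂ S hS S' hS' hne v hv w hw).2 hvw
  have h₀ : Layered G ∅ ∅ (fun _ => 0) 0 := ⟨by simp, by simp, by simp, by simp, by simp⟩
  obtain ⟨I₁, l₁, h₁, -⟩ := h₀.exists_extend_of_rank hG hs (W := {v | ∀ S ∈ F, v ∉ S}) (d := d)
    (D := 10 * m + 8) (by simp) (fun w _ => hd w) (by
      intro w hw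
      rcases hdF w hw with h | ⟨w', hww', hlt⟩
      · exact .inl h
      · exact .inr ⟨w', hww', by simp, fun _ => hlt⟩)
  rw [Set.empty_union, zero_add] at h₁
  have hcomp : ∀ S ∈ F, _ := fun S hS =>
    (hF₁ S hS).1 I₁ fun j hj => h₁.subset hj S hS
  choose! A hAS r hrS hrA hconn hAind hAJ hex using hcomp
  obtain ⟨I₂, l₂, h₂, hI₂, hW₂⟩ := h₁.exists_extend (W := {v | ∃ S ∈ F, v ∈ A S}) (by
      rintro w ⟨S, hS, hw⟩ hw'
      exact hw' S hS (hAS S hS hw)) (by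
      rintro a ⟨S, hS, ha⟩ b ⟨S', hS', hb⟩ hab
      obtain rfl := hadj S hS S' hS' a (hAS S hS ha) b (hAS S' hS' hb) hab
      exact hAind S hS a ha b hb hab) (by
      rintro w ⟨S, hS, hw⟩
      exact .inl fun i hi => hAJ S hS w hw i hi)
  have hAI₂ : ∀ S ∈ F, ∀ a ∈ A S, a ∈ I₂ := fun S hS a ha =>
    (hW₂ a ⟨S, hS, ha⟩).2 fun i hi => hAJ S hS a ha i hi
  have hrank : ∀ S ∈ F, _ := fun S hS =>
    (hconn S hS).exists_rank (r := r S) (Finset.mem_sdiff.2 ⟨hrS S hS, hrA S hS⟩)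
  choose! e he using hrank
  have howner : ∀ v, ∃ S, ∀ S' ∈ F, v ∈ S' → S' = S := by
    intro v
    by_cases h : ∃ S ∈ F, v ∈ S
    · obtain ⟨S, hS, hv⟩ := h
      exact ⟨S, fun S' hS' hv' => huniq S' hS' S hS v hv' hv⟩
    · exact ⟨∅, fun S' hS' hv' => absurd ⟨S', hS', hv'⟩ h⟩
  choose o ho using howner
  obtain ⟨I₃, l₃, h₃, hI₃⟩ := h₂.exists_extend_of_rank hG hs
    (W := {v | ∃ S ∈ F, v ∈ S ∧ v ∉ A S ∧ v ≠ r S}) (d := fun v => e (o v) v)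
    (D := 8 * m + 6) (by
      rintro w ⟨S, hS, hw, hwA, -⟩ (hw' | ⟨S', hS', hw'⟩)
      · exact hw' S hS hw
      · obtain rfl := huniq S hS S' hS' w hw (hAS S' hS' hw')
        exact hwA hw') (by
      rintro w ⟨S, hS, hw, hwA, -⟩
      rw [← ho w S hS hw]
      calc e S w < (S \ A S).card := (he S hS w (Finset.mem_sdiff.2 ⟨hw, hwA⟩)).1
        _ ≤ S.card := Finset.card_le_card Finset.sdiff_subset
        _ ≤ _ := (hF₁ S hS).2) (by
      rintro w ⟨S, hS, hw, hwA, hwr⟩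
      obtain ⟨w', hw', hww', hlt⟩ := (he S hS w (Finset.mem_sdiff.2 ⟨hw, hwA⟩)).2 hwr
      obtain ⟨hw'S, hw'A⟩ := Finset.mem_sdiff.1 hw'
      refine .inr ⟨w', hww', ?_, fun _ => ?_⟩
      · rintro (h | ⟨S', hS', h⟩)
        · exact h S hS hw'S
        · obtain rfl := huniq S hS S' hS' w' hw'S (hAS S' hS' h)
          exact hw'A h
      · rwa [← ho w S hS hw, ← ho w' S hS hw'S])
  have hI₁I₃ : ∀ v ∈ I₁, v ∈ I₃ := fun v hv =>
    (hI₃ v (.inl (h₁.subset hv))).2 ((hI₂ v (h₁.subset hv)).2 hv)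
  have hAI₃ : ∀ S ∈ F, ∀ a ∈ A S, a ∈ I₃ := fun S hS a ha =>
    (hI₃ a (.inr ⟨S, hS, ha⟩)).2 (hAI₂ S hS a ha)
  obtain ⟨I₄, l₄, h₄, -, -⟩ := h₃.exists_extend (W := {v | ∃ S ∈ F, v = r S}) (by
      rintro _ ⟨S, hS, rfl⟩ ((h | ⟨S', hS', h⟩) | ⟨S', hS', h, -, hne⟩)
      · exact h S hS (hrS S hS)
      · obtain rfl := huniq S hS S' hS' _ (hrS S hS) (hAS S' hS' h)
        exact hrA S hS h
      · obtain rfl := huniq S hS S' hS' _ (hrS S hS) h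
        exact hne rfl) (by
      rintro _ ⟨S, hS, rfl⟩ _ ⟨S', hS', rfl⟩ hab
      obtain rfl := hadj S hS S' hS' _ (hrS S hS) _ (hrS S' hS') hab
      exact G.irrefl hab) (by
      rintro _ ⟨S, hS, rfl⟩
      refine .inr fun a _ ha b _ hb hra hrb => ?_
      obtain ⟨i₁, i₂, hne, h1, h2, hr1, hr2⟩ := hex S hS
      have hi₁ : i₁ ∈ I₃ := h1.elim (hAI₃ S hS i₁) (hI₁I₃ i₁)
      have hi₂ : i₂ ∈ I₃ := h2.elim (hAI₃ S hS i₂) (hI₁I₃ i₂)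
      rcases hG hr1 hr2 hra hrb with h | h | h | h | h | h
      · exact absurd h hne
      · exact absurd (h ▸ hi₁) ha
      · exact absurd (h ▸ hi₁) hb
      · exact absurd (h ▸ hi₂) ha
      · exact absurd (h ▸ hi₂) hb
      · exact h)
  refine ⟨I₄, l₄, ?_⟩
  convert h₄ using 1
  · refine (Set.eq_univ_of_forall fun v => ?_).symm
    by_cases h : ∃ S ∈ F, v ∈ S
    · obtain ⟨S, hS, hv⟩ := h
      by_cases hA : v ∈ A S
      · exact .inl (.inl (.inr ⟨S, hS, hA⟩))
      by_cases hr : v = r S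
      · exact .inr ⟨S, hS, hr⟩
      · exact .inl (.inr ⟨S, hS, hv, hA, hr⟩)
    · exact .inl (.inl (.inl fun S hS hv => h ⟨S, hS, hv⟩))
  · ring

end Assembly

section Schedule

variable {V : Type*} {G : SimpleGraph V} {I : Set V} {l : V → ℕ} {N : ℕ}

theorem Layered.exists_labeling (h : Layered G Set.univ I l N) {α : Type*} (B : V → α → Prop)
    (R : α → α → Prop) (hR : ∀ a b, R a b → R b a) (hB : ∀ v, ∃ a, B v a)
    (hstep : ∀ u v, u ∉ I → G.Adj v u → l u < l v → ∀ b, B u b → ∃ a, B v a ∧ R a b) :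
    ∃ f : V → α, (∀ v ∉ I, B v (f v)) ∧ ∀ u ∉ I, ∀ v ∉ I, G.Adj u v → R (f u) (f v) := by
  classical
  have main : ∀ k, ∃ f : V → α, (∀ v, v ∉ I → l v < k → B v (f v)) ∧
      ∀ u v, u ∉ I → v ∉ I → l u < k → l v < k → G.Adj u v → R (f u) (f v) := by
    intro k
    induction k with
    | zero =>
      choose f hf using hB
      exact ⟨f, fun v _ _ => hf v, by simp⟩
    | succ k ih =>
      obtain ⟨f, hf, hfR⟩ := ih
      have hext : ∀ v, ∃ a, B v a ∧ (l v = k → v ∉ I →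
          ∀ u, u ∉ I → G.Adj v u → l u < k → R a (f u)) := by
        intro v
        by_cases hv : l v = k ∧ v ∉ I ∧ ∃ u, u ∉ I ∧ G.Adj v u ∧ l u < k
        · obtain ⟨hvk, hvI, u, hu, hvu, hlu⟩ := hv
          obtain ⟨a, ha, hau⟩ := hstep u v hu hvu (by omega) (f u) (hf u hu hlu)
          refine ⟨a, ha, fun _ _ u' hu' hvu' hlu' => ?_⟩
          obtain rfl := h.unique v trivial hvI u trivial hu u' trivial hu' hvu hvu'
            (by omega) (by omega)
          exact hau
        · obtain ⟨a, ha⟩ := hB v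
          exact ⟨a, ha, fun h1 h2 u h3 h4 h5 => absurd ⟨h1, h2, u, h3, h4, h5⟩ hv⟩
      choose g hgB hgR using hext
      refine ⟨fun v => if l v < k then f v else g v, fun v hv _ => ?_, fun u v hu hv hlu hlv huv => ?_⟩
      · by_cases hk : l v < k
        · simpa [hk] using hf v hv hk
        · simpa [hk] using hgB v
      · have hne := h.ne u trivial hu v trivial hv huv
        by_cases hku : l u < k
        · by_cases hkv : l v < k
          · simpa [hku, hkv] using hfR u v hu hv hku hkv huv
          · simpa [hku, hkv] using hR _ _ (hgR v (by omega) hv u hu huv.symm hku)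
        · have hkv : l v < k := by omega
          simpa [hku, hkv] using hgR u (by omega) hu v hv huv hkv
  obtain ⟨f, hf, hfR⟩ := main N
  exact ⟨f, fun v hv => hf v hv (h.lt v trivial hv), fun u hu v hv =>
    hfR u v hu hv (h.lt u trivial hu) (h.lt v trivial hv)⟩

/-- Lift two 3-colorings simultaneously to height functions of equal parity. -/
theorem Layered.exists_heights (h : Layered G Set.univ I l N) {s t : V → ℕ}
    (hs : IsProperColoring G 3 s) (ht : IsProperColoring G 3 t) :
    ∃ f : V → ℕ × ℕ, (∀ v ∉ I, (f v).1 % 3 = s v % 3 ∧ (f v).2 % 3 = t v % 3 ∧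
      (f v).1 % 2 = (f v).2 % 2 ∧ (f v).1 < 7 * N + 31 ∧ (f v).2 < 7 * N + 31) ∧
      ∀ u ∉ I, ∀ v ∉ I, G.Adj u v → ((f u).1 = (f v).1 + 1 ∨ (f v).1 = (f u).1 + 1) ∧
        ((f u).2 = (f v).2 + 1 ∨ (f v).2 = (f u).2 + 1) := by
  have hs3 : ∀ v, 1 ≤ s v ∧ s v ≤ 3 := fun v => Finset.mem_Icc.1 (hs.1 v)
  have ht3 : ∀ v, 1 ≤ t v ∧ t v ≤ 3 := fun v => Finset.mem_Icc.1 (ht.1 v)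
  have lift : ∀ b x y l₁ l₂ : ℕ, x ≠ y → 1 ≤ x → x ≤ 3 → 1 ≤ y → y ≤ 3 → l₁ < l₂ → l₁ < N →
      b % 3 = x % 3 → b ≤ 6 * N + 30 + l₁ → 6 * N + 6 ≤ b + l₁ →
      ∃ a, a % 3 = y % 3 ∧ a ≤ 6 * N + 30 + l₂ ∧ 6 * N + 6 ≤ a + l₂ ∧ (a = b + 1 ∨ b = a + 1) := by
    intro b x y l₁ l₂ _ _ _ _ _ _ _ _ _ _
    by_cases hb : (b + 1) % 3 = y % 3
    · exact ⟨b + 1, by omega⟩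
    · exact ⟨b - 1, by omega⟩
  obtain ⟨f, hf, hfR⟩ := h.exists_labeling
    (fun v (a : ℕ × ℕ) => a.1 % 3 = s v % 3 ∧ a.2 % 3 = t v % 3 ∧ a.1 % 2 = a.2 % 2 ∧
      (a.1 ≤ 6 * N + 30 + l v ∧ 6 * N + 6 ≤ a.1 + l v) ∧
      a.2 ≤ 6 * N + 30 + l v ∧ 6 * N + 6 ≤ a.2 + l v)
    (fun a b => (a.1 = b.1 + 1 ∨ b.1 = a.1 + 1) ∧ (a.2 = b.2 + 1 ∨ b.2 = a.2 + 1))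
    (fun a b hab => ⟨hab.1.symm, hab.2.symm⟩)
    (fun v => by
      have := hs3 v
      have := ht3 v
      exact ⟨(6 * N + 18 + 4 * s v, 6 * N + 18 + 4 * t v), by dsimp only; omega⟩)
    (by
      rintro u v hu hvu hlt ⟨b₁, b₂⟩ ⟨h1, h2, h3, ⟨h4, h5⟩, h6, h7⟩
      obtain ⟨a₁, k1, k2, k3, k4⟩ := lift b₁ (s u) (s v) (l u) (l v) (hs.2 hvu).symm (hs3 u).1
        (hs3 u).2 (hs3 v).1 (hs3 v).2 hlt (h.lt u trivial hu) h1 h4 h5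
      obtain ⟨a₂, m1, m2, m3, m4⟩ := lift b₂ (t u) (t v) (l u) (l v) (ht.2 hvu).symm (ht3 u).1
        (ht3 u).2 (ht3 v).1 (ht3 v).2 hlt (h.lt u trivial hu) h2 h6 h7
      refine ⟨(a₁, a₂), ⟨k1, m1, ?_, ⟨k2, k3⟩, m2, m3⟩, k4, m4⟩
      dsimp only at h3 ⊢
      omega)
  refine ⟨f, fun v hv => ?_, hfR⟩
  obtain ⟨h1, h2, h3, ⟨h4, h5⟩, h6, h7⟩ := hf v hv
  have := h.lt v trivial hv
  refine ⟨h1, h2, h3, by omega, by omega⟩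

theorem IsRecolorSchedule.reverse {m n : ℕ} {x y : V → ℕ} {X : ℕ → V → ℕ}
    (h : IsRecolorSchedule G m x y n X) : IsRecolorSchedule G m y x n fun i => X (n - i) := by
  obtain ⟨h0, hn, hp, hstep⟩ := h
  refine ⟨by simpa using hn, by simpa using h0, fun i _ => hp _ (by omega),
    fun i h1 h2 u v huv => ?_⟩
  have := hstep (n - (i - 1)) (by omega) (by omega) huv
  rw [show n - (i - 1) - 1 = n - i by omega] at this
  exact this.imp Eq.symm Eq.symm

theorem IsRecolorSchedule.append {m a b : ℕ} {x y z : V → ℕ} {X Y : ℕ → V → ℕ}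
    (hX : IsRecolorSchedule G m x y a X) (hY : IsRecolorSchedule G m y z b Y) :
    IsRecolorSchedule G m x z (a + b) fun i => if i ≤ a then X i else Y (i - a) := by
  obtain ⟨h0, hn, hp, hstep⟩ := hX
  obtain ⟨k0, kn, kp, kstep⟩ := hY
  refine ⟨by simpa using h0, ?_, fun i hi => ?_, fun i h1 h2 u v huv => ?_⟩
  · dsimp only
    split_ifs with hab
    · obtain rfl : b = 0 := by omega
      rw [← kn, k0, add_zero, hn]
    · rw [Nat.add_sub_cancel_left, kn]
  · dsimp only
    split_ifs with hia
    · exact hp i hia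
    · exact kp _ (by omega)
  · dsimp only
    by_cases hia : i ≤ a
    · rw [if_pos hia, if_pos (by omega)]
      exact hstep i h1 hia huv
    · rw [if_neg hia]
      have := kstep (i - a) (by omega) (by omega) huv
      by_cases hia' : i - 1 ≤ a
      · obtain rfl : i = a + 1 := by omega
        rw [if_pos hia']
        simp only [Nat.add_sub_cancel_left, Nat.sub_self, k0] at this
        simpa [hn] using this
      · rw [if_neg hia', show i - 1 - a = i - a - 1 by omega]
        exact this

/-- Heights below `i` are replaced by the value of the same parity among `i` and `i + 1`. -/
def truncateBelow (i a : ℕ) : ℕ := if i ≤ a then a else i + (i + a) % 2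

/-- The 4-coloring which is `4` on `I` and given elsewhere by the residues modulo three of the
truncated heights. -/
noncomputable def heightColoring (I : Set V) (f : V → ℕ) (i : ℕ) (v : V) : ℕ :=
  open Classical in if v ∈ I then 4 else (truncateBelow i (f v) + 2) % 3 + 1

theorem exists_schedule_heightColoring {s f : V → ℕ} (hs : IsProperColoring G 3 s)
    (hI : ∀ a ∈ I, ∀ b ∈ I, ¬ G.Adj a b) (hfs : ∀ v ∉ I, f v % 3 = s v % 3)
    (hf : ∀ u ∉ I, ∀ v ∉ I, G.Adj u v → f u = f v + 1 ∨ f v = f u + 1) (K : ℕ) :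
    ∃ X, IsRecolorSchedule G 4 s (heightColoring I f K) (1 + K) X := by
  have hs3 : ∀ v, 1 ≤ s v ∧ s v ≤ 3 := fun v => Finset.mem_Icc.1 (hs.1 v)
  have hproper : ∀ i, IsProperColoring G 4 (heightColoring I f i) := by
    intro i
    refine ⟨fun v => ?_, fun u v huv => ?_⟩
    · rw [Finset.mem_Icc]
      unfold heightColoring
      split_ifs
      · omega
      · omega
    · unfold heightColoring
      split_ifs with hu hv hv
      · exact absurd huv (hI u hu v hv)
      · omega
      · omega
      · have := hf u hu v hv huv
        unfold truncateBelow
        split_ifs <;> omega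
  have h₁ : IsRecolorSchedule G 4 s (heightColoring I f 0) 1
      fun i => if i = 0 then s else heightColoring I f 0 := by
    refine ⟨by simp, by simp, fun i _ => ?_, fun i h1 h2 u v huv => ?_⟩
    · dsimp only
      split_ifs
      · exact ⟨fun v => Finset.mem_Icc.2 ⟨(hs3 v).1, (hs3 v).2.trans (by omega)⟩, hs.2⟩
      · exact hproper 0
    · obtain rfl : i = 1 := by omega
      have hsame : ∀ w ∉ I, s w = heightColoring I f 0 w := by
        intro w hw
        have := hfs w hw
        have := hs3 w
        simp only [heightColoring, truncateBelow, hw, if_false, Nat.zero_le, if_true]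
        omega
      simp only [Nat.sub_self, if_true, one_ne_zero, if_false]
      by_cases hu : u ∈ I
      · exact .inr (hsame v fun hv => hI u hu v hv huv)
      · exact .inl (hsame u hu)
  have h₂ : IsRecolorSchedule G 4 (heightColoring I f 0) (heightColoring I f K) K
      (heightColoring I f) := by
    refine ⟨rfl, rfl, fun i _ => hproper i, fun i h1 h2 u v huv => ?_⟩
    by_cases hu : u ∈ I
    · exact .inl (by simp [heightColoring, hu])
    by_cases hv : v ∈ I
    · exact .inr (by simp [heightColoring, hv])
    have := hf u hu v hv huv
    have hor : truncateBelow (i - 1) (f u) = truncateBelow i (f u) ∨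
        truncateBelow (i - 1) (f v) = truncateBelow i (f v) := by
      unfold truncateBelow
      split_ifs <;> omega
    refine hor.imp (fun h => ?_) fun h => ?_
    · simp only [heightColoring, h]
    · simp only [heightColoring, h]
  exact ⟨_, h₁.append h₂⟩

theorem Layered.exists_schedule (h : Layered G Set.univ I l N) {s t : V → ℕ}
    (hs : IsProperColoring G 3 s) (ht : IsProperColoring G 3 t) :
    ∃ X, IsRecolorSchedule G 4 s t (14 * N + 64) X := by
  obtain ⟨f, hf, hfR⟩ := h.exists_heights hs ht
  obtain ⟨X, hX⟩ := exists_schedule_heightColoring hs h.indep (f := fun v => (f v).1)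
    (fun v hv => (hf v hv).1) (fun u hu v hv huv => (hfR u hu v hv huv).1) (7 * N + 31)
  obtain ⟨Y, hY⟩ := exists_schedule_heightColoring ht h.indep (f := fun v => (f v).2)
    (fun v hv => (hf v hv).2.1) (fun u hu v hv huv => (hfR u hu v hv huv).2) (7 * N + 31)
  have heq : heightColoring I (fun v => (f v).1) (7 * N + 31) =
      heightColoring I (fun v => (f v).2) (7 * N + 31) := by
    funext v
    by_cases hv : v ∈ I
    · simp [heightColoring, hv]
    · obtain ⟨-, -, h1, h2, h3⟩ := hf v hv
      simp only [heightColoring, truncateBelow, hv, if_false, if_neg h2.not_ge, if_neg h3.not_ge]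
      omega
  rw [heq] at hX
  rw [show 14 * N + 64 = 1 + (7 * N + 31) + (1 + (7 * N + 31)) by ring]
  exact ⟨_, hX.append hY.reverse⟩

end Schedule

theorem subcubic_of_degree_le {V : Type*} [Fintype V] (G : SimpleGraph V) [DecidableRel G.Adj]
    (hG : ∀ v : V, G.degree v ≤ 3) : Subcubic G := by
  classical
  intro v a b c d ha hb hc hd
  by_contra hcon
  push Not at hcon
  obtain ⟨h1, h2, h3, h4, h5, h6⟩ := hcon
  have hsub : ({a, b, c, d} : Finset V) ⊆ G.neighborFinset v := by
    intro x hx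
    simp only [Finset.mem_insert, Finset.mem_singleton] at hx
    rw [mem_neighborFinset]
    rcases hx with rfl | rfl | rfl | rfl <;> assumption
  have hcard : ({a, b, c, d} : Finset V).card = 4 := by
    simp [h1, h2, h3, h4, h5, h6]
  have := Finset.card_le_card hsub
  rw [hcard, card_neighborFinset_eq_degree] at this
  have := hG v
  omega

/-- 3+1 recoloring in subcubic graphs: a schedule of length `O(log n)` always exists. -/
theorem stmt_14 :
    ∃ C : ℝ, ∀ (V : Type) [Fintype V] (G : SimpleGraph V) [DecidableRel G.Adj],
      2 ≤ Fintype.card V → (∀ v : V, G.degree v ≤ 3) →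
      ∀ s t : V → ℕ, IsProperColoring G 3 s → IsProperColoring G 3 t →
      ∃ (ℓ : ℕ) (X : ℕ → V → ℕ), IsRecolorSchedule G 4 s t ℓ X ∧
        (ℓ : ℝ) ≤ C * Real.logb 2 (Fintype.card V) := by
  refine ⟨2192, fun V _ G _ hcard hG s t hs ht => ?_⟩
  obtain ⟨I, l, h⟩ := exists_layered_univ (subcubic_of_degree_le G hG) hs
    (Nat.lt_pow_succ_log_self one_lt_two (Fintype.card V))
  obtain ⟨X, hX⟩ := h.exists_schedule hs ht
  refine ⟨_, X, hX, ?_⟩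
  have hlog : 1 ≤ Nat.log 2 (Fintype.card V) := Nat.log_pos one_lt_two hcard
  calc ((14 * (54 * (Nat.log 2 (Fintype.card V)).succ + 44) + 64 : ℕ) : ℝ)
      ≤ ((2192 * Nat.log 2 (Fintype.card V) : ℕ) : ℝ) := by
        exact_mod_cast (by omega)
    _ = 2192 * (Nat.log 2 (Fintype.card V) : ℝ) := by push_cast; rfl
    _ ≤ 2192 * Real.logb 2 (Fintype.card V) := by
        have := Real.natLog_le_logb (Fintype.card V) 2
        push_cast at this
        linarith
end
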